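/- arXiv:1310.1076 — 11 statements merged into one kernel-verified Lean document; each statement's English description precedes it below -/
import Mathlib

section
/- Let α ∈ (0, 1/2] and t > 0. Let u₁, u₂ be i.i.d. uniform on (0, π), and w₁, w₂ be i.i.d. exponential with rate 1, with (u₁, u₂, w₁, w₂) mutually independent (i.e., work under the product measure Unif(0,π) ⊗ Unif(0,π) ⊗ Exp(1) ⊗ Exp(1)). Then the probability of the event { q_α(u₂)·w₁ ≤ t·q_α(u₁)·w₂ } equals F_α(t), i.e., P(Q_α(u₁,u₂)·w₁/w₂ ≤ t) = (1/π²) ∫₀^π ∫₀^π 1/(1 + Q_α(u₁,u₂)/t) du₁ du₂. -/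
open MeasureTheory ProbabilityTheory Real

/-- The uniform distribution on the interval `(0, π)`. -/
noncomputable def unifMeasure : Measure ℝ :=
  (ENNReal.ofReal Real.pi)⁻¹ • (volume.restrict (Set.Ioo (0:ℝ) Real.pi))

/-- `q_α(u) = (sin(α u))^{α/(1−α)} · (sin u)^{−1/(1−α)} · sin((1−α)u)`. -/
noncomputable def q (α u : ℝ) : ℝ :=
  Real.sin (α * u) ^ (α / (1 - α)) * Real.sin u ^ (-(1 / (1 - α))) * Real.sin ((1 - α) * u)

/-- `Q_α(u₁,u₂) = q_α(u₂)/q_α(u₁) = (sin(α u₂)/sin(α u₁))^{α/(1−α)} · (sin u₁/sin u₂)^{1/(1−α)}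
· sin((1−α)u₂)/sin((1−α)u₁)`. -/
noncomputable def Q (α u₁ u₂ : ℝ) : ℝ :=
  (Real.sin (α * u₂) / Real.sin (α * u₁)) ^ (α / (1 - α)) *
    (Real.sin u₁ / Real.sin u₂) ^ (1 / (1 - α)) *
    (Real.sin ((1 - α) * u₂) / Real.sin ((1 - α) * u₁))

/-- `F_α(t) = (1/π²) ∫₀^π ∫₀^π 1/(1 + Q_α(u₁,u₂)/t) du₁ du₂`. -/
noncomputable def F (α t : ℝ) : ℝ :=
  (1 / Real.pi ^ 2) *
    ∫ u₁ in (0:ℝ)..Real.pi, ∫ u₂ in (0:ℝ)..Real.pi, 1 / (1 + Q α u₁ u₂ / t)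

lemma aux_lint (c x : ℝ) (hc : 0 < c) :
    ∫⁻ y in Set.Ici x, ENNReal.ofReal (Real.exp (-(c * y)))
      = ENNReal.ofReal (Real.exp (-(c * x)) / c) := by
  rw [← setLIntegral_congr (Ioi_ae_eq_Ici (μ := volume) (a := x))]
  have hi : IntegrableOn (fun y => Real.exp (-(c * y))) (Set.Ioi x) := by
    have := integrableOn_exp_mul_Ioi (a := -c) (by linarith) x
    simpa only [neg_mul] using this
  rw [← ofReal_integral_eq_lintegral_ofReal hi (Filter.Eventually.of_forall fun y => (Real.exp_pos _).le)]
  congr 1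
  have := integral_exp_mul_Ioi (a := -c) (by linarith) x
  simp only [neg_mul] at this
  rw [this, div_neg, neg_div, neg_neg]

lemma expMeasure_eq : expMeasure 1 = volume.withDensity (exponentialPDF 1) := rfl

lemma measurable_expPDF : Measurable (exponentialPDF 1) :=
  (measurable_exponentialPDFReal 1).ennreal_ofReal

lemma exp_tail (x : ℝ) (hx : 0 ≤ x) :
    expMeasure 1 (Set.Ici x) = ENNReal.ofReal (Real.exp (-x)) := by
  rw [expMeasure_eq, withDensity_apply _ measurableSet_Ici]
  rw [setLIntegral_congr_fun (g := fun y => ENNReal.ofReal (Real.exp (-(1 * y)))) measurableSet_Ici]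
  · rw [aux_lint 1 x one_pos]; simp
  · intro y hy
    simp only [Set.mem_Ici] at hy
    simp only
    rw [exponentialPDF_of_nonneg (hx.trans hy), one_mul]

lemma exp_pair (a b : ℝ) (ha : 0 < a) (hb : 0 < b) :
    ((expMeasure 1).prod (expMeasure 1)) {w : ℝ × ℝ | a * w.1 ≤ b * w.2}
      = ENNReal.ofReal (1 / (1 + a / b)) := by
  have := isProbabilityMeasure_expMeasure one_pos
  have hm : MeasurableSet {w : ℝ × ℝ | a * w.1 ≤ b * w.2} :=
    measurableSet_le (by fun_prop) (by fun_prop)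
  rw [Measure.prod_apply hm]
  have hs : ∀ x : ℝ, Prod.mk x ⁻¹' {w : ℝ × ℝ | a * w.1 ≤ b * w.2} = Set.Ici (a / b * x) := by
    intro x
    ext y
    simp only [Set.mem_preimage, Set.mem_ofPred_eq, Set.mem_Ici]
    rw [div_mul_eq_mul_div, div_le_iff₀ hb, mul_comm y b]
  simp only [hs]
  have hmeas : Measurable fun x : ℝ => expMeasure 1 (Set.Ici (a / b * x)) := by
    have := measurable_measure_prodMk_left (ν := expMeasure 1) hm
    simpa only [hs] using this
  have hab : 0 < a / b := div_pos ha hb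
  change ∫⁻ x, expMeasure 1 (Set.Ici (a / b * x)) ∂(volume.withDensity (exponentialPDF 1)) = _
  rw [lintegral_withDensity_eq_lintegral_mul _ measurable_expPDF hmeas]
  have : ∀ x : ℝ, (exponentialPDF 1 * fun x : ℝ => expMeasure 1 (Set.Ici (a / b * x))) x
      = (Set.Ici (0:ℝ)).indicator (fun x => ENNReal.ofReal (Real.exp (-((1 + a / b) * x)))) x := by
    intro x
    by_cases hx : 0 ≤ x
    · rw [Set.indicator_of_mem (by exact hx), Pi.mul_apply, exponentialPDF_of_nonneg hx,
        exp_tail _ (by positivity), ← ENNReal.ofReal_mul (by positivity), one_mul, one_mul,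
        ← Real.exp_add]
      congr 2; ring
    · rw [Set.indicator_of_notMem (by exact hx), Pi.mul_apply,
        exponentialPDF_of_neg (not_le.1 hx), zero_mul]
  simp only [this]
  rw [lintegral_indicator measurableSet_Ici, aux_lint _ _ (by positivity)]
  simp

lemma sins_pos {α u : ℝ} (hα : α ∈ Set.Ioc (0:ℝ) (1/2)) (hu : u ∈ Set.Ioo 0 Real.pi) :
    0 < Real.sin (α * u) ∧ 0 < Real.sin u ∧ 0 < Real.sin ((1 - α) * u) := by
  obtain ⟨h1, h2⟩ := hα
  obtain ⟨h3, h4⟩ := hu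
  refine ⟨Real.sin_pos_of_pos_of_lt_pi (by positivity) (by nlinarith),
    Real.sin_pos_of_pos_of_lt_pi h3 h4,
    Real.sin_pos_of_pos_of_lt_pi (mul_pos (by linarith) h3) (by nlinarith)⟩

lemma q_pos {α u : ℝ} (hα : α ∈ Set.Ioc (0:ℝ) (1/2)) (hu : u ∈ Set.Ioo 0 Real.pi) :
    0 < q α u := by
  obtain ⟨h1, h2, h3⟩ := sins_pos hα hu
  unfold q; positivity

lemma Q_eq {α u v : ℝ} (hα : α ∈ Set.Ioc (0:ℝ) (1/2)) (hu : u ∈ Set.Ioo 0 Real.pi)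
    (hv : v ∈ Set.Ioo 0 Real.pi) : Q α u v = q α v / q α u := by
  obtain ⟨h1, h2, h3⟩ := sins_pos hα hu
  obtain ⟨k1, k2, k3⟩ := sins_pos hα hv
  unfold q Q
  rw [Real.div_rpow k1.le h1.le, Real.div_rpow h2.le k2.le, Real.rpow_neg h2.le,
    Real.rpow_neg k2.le]
  have := Real.rpow_pos_of_pos h1 (α / (1 - α))
  have := Real.rpow_pos_of_pos h2 (1 / (1 - α))
  have := Real.rpow_pos_of_pos k2 (1 / (1 - α))
  generalize Real.sin (α * u) ^ (α / (1 - α)) = A at *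
  generalize Real.sin u ^ (1 / (1 - α)) = B at *
  generalize Real.sin v ^ (1 / (1 - α)) = C at *
  field_simp

lemma measurable_q (α : ℝ) : Measurable (q α) := by
  unfold q; fun_prop

lemma measurable_Q (α : ℝ) : Measurable (fun p : ℝ × ℝ => Q α p.1 p.2) := by
  unfold Q; fun_prop

/-- Let `α ∈ (0, 1/2]` and `t > 0`. Under the product measure
`Unif(0,π) ⊗ Unif(0,π) ⊗ Exp(1) ⊗ Exp(1)` for `(u₁, u₂, w₁, w₂)`, the probability of the event
`{ q_α(u₂)·w₁ ≤ t·q_α(u₁)·w₂ }` equals `F_α(t)`. -/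
theorem stmt_0 (α t : ℝ) (hα : α ∈ Set.Ioc (0:ℝ) (1/2)) (ht : 0 < t) :
    (unifMeasure.prod (unifMeasure.prod ((expMeasure 1).prod (expMeasure 1))))
        {p : ℝ × ℝ × ℝ × ℝ | q α p.2.1 * p.2.2.1 ≤ t * (q α p.1 * p.2.2.2)}
      = ENNReal.ofReal (F α t) := by
  have := isProbabilityMeasure_expMeasure one_pos
  have hc : (ENNReal.ofReal Real.pi)⁻¹ ≠ ⊤ := by simp [Real.pi_pos]
  have : IsFiniteMeasure unifMeasure := by
    unfold unifMeasure
    exact Measure.smul_finite _ hc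
  have hq := measurable_q α
  have hm : MeasurableSet
      {p : ℝ × ℝ × ℝ × ℝ | q α p.2.1 * p.2.2.1 ≤ t * (q α p.1 * p.2.2.2)} :=
    measurableSet_le (by fun_prop) (by fun_prop)
  set ν := volume.restrict (Set.Ioo (0:ℝ) Real.pi) with hν
  have hae : ∀ᵐ u ∂ν, u ∈ Set.Ioo (0:ℝ) Real.pi := ae_restrict_mem measurableSet_Ioo
  have haep : ∀ᵐ p ∂(ν.prod ν), p ∈ Set.Ioo (0:ℝ) Real.pi ×ˢ Set.Ioo (0:ℝ) Real.pi := by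
    rw [hν, Measure.prod_restrict]
    exact ae_restrict_mem (measurableSet_Ioo.prod measurableSet_Ioo)
  have hQm := measurable_Q α
  have hfm : Measurable (fun p : ℝ × ℝ => 1 / (1 + Q α p.1 p.2 / t)) := by fun_prop
  have hb : ∀ᵐ p ∂(ν.prod ν), 0 ≤ 1 / (1 + Q α p.1 p.2 / t) ∧ 1 / (1 + Q α p.1 p.2 / t) ≤ 1 := by
    filter_upwards [haep] with p hp
    have h0 : 0 < Q α p.1 p.2 / t := by
      rw [Q_eq hα hp.1 hp.2]
      exact div_pos (div_pos (q_pos hα hp.2) (q_pos hα hp.1)) ht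
    refine ⟨by positivity, ?_⟩
    rw [div_le_one (by positivity)]
    linarith
  have hint : Integrable (fun p : ℝ × ℝ => 1 / (1 + Q α p.1 p.2 / t)) (ν.prod ν) := by
    refine Integrable.of_bound hfm.aestronglyMeasurable 1 ?_
    filter_upwards [hb] with p hp
    rw [Real.norm_of_nonneg hp.1]; exact hp.2
  have hF : F α t = (1 / Real.pi ^ 2) * ∫ p, 1 / (1 + Q α p.1 p.2 / t) ∂(ν.prod ν) := by
    unfold F
    rw [integral_prod _ hint]
    simp only [intervalIntegral.integral_of_le Real.pi_pos.le, integral_Ioc_eq_integral_Ioo]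
    rfl
  rw [hF, ENNReal.ofReal_mul (by positivity),
    ofReal_integral_eq_lintegral_ofReal hint (hb.mono fun p hp => hp.1),
    lintegral_prod _ hfm.ennreal_ofReal.aemeasurable]
  rw [Measure.prod_apply hm]
  have h1 : ∀ u ∈ Set.Ioo (0:ℝ) Real.pi,
      (unifMeasure.prod ((expMeasure 1).prod (expMeasure 1)))
        (Prod.mk u ⁻¹' {p : ℝ × ℝ × ℝ × ℝ | q α p.2.1 * p.2.2.1 ≤ t * (q α p.1 * p.2.2.2)})
      = (ENNReal.ofReal Real.pi)⁻¹ * ∫⁻ v, ENNReal.ofReal (1 / (1 + Q α u v / t)) ∂ν := by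
    intro u hu
    rw [Measure.prod_apply (measurable_prodMk_left hm), unifMeasure, lintegral_smul_measure,
      smul_eq_mul]
    congr 1
    refine lintegral_congr_ae ?_
    filter_upwards [hae] with v hv
    have := exp_pair (q α v) (t * q α u) (q_pos hα hv) (mul_pos ht (q_pos hα hu))
    rw [Q_eq hα hu hv, div_div, mul_comm (q α u) t, ← this]
    congr 1
    ext w
    simp [mul_assoc]
  have h2 : ∀ f : ℝ → ENNReal,
      ∫⁻ u, f u ∂unifMeasure = (ENNReal.ofReal Real.pi)⁻¹ * ∫⁻ u, f u ∂ν := by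
    intro f
    rw [unifMeasure, lintegral_smul_measure, smul_eq_mul]
  rw [h2]
  rw [lintegral_congr_ae (hae.mono fun u hu => h1 u hu)]
  rw [lintegral_const_mul' _ _ hc, ← mul_assoc]
  congr 1
  rw [← ENNReal.ofReal_inv_of_pos Real.pi_pos, ← ENNReal.ofReal_mul (by positivity)]
  congr 1
  field_simp
end

section
/- For every t > 0, F_{1/2}(t) = (2/π)·arctan(√t), i.e., (1/π²) ∫₀^π ∫₀^π 1/(1 + Q_{1/2}(u₁,u₂)/t) du₁ du₂ = (2/π)·arctan(√t). -/
open Real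

theorem congr_Ioo_aux (f g : ℝ → ℝ) (h : ∀ x ∈ Set.Ioo (0:ℝ) Real.pi, f x = g x) :
    ∫ x in (0:ℝ)..Real.pi, f x = ∫ x in (0:ℝ)..Real.pi, g x := by
  rw [intervalIntegral.integral_of_le Real.pi_pos.le, intervalIntegral.integral_of_le Real.pi_pos.le,
    MeasureTheory.integral_Ioc_eq_integral_Ioo, MeasureTheory.integral_Ioc_eq_integral_Ioo]
  exact MeasureTheory.setIntegral_congr_fun measurableSet_Ioo h

theorem cos_half_pos_aux (u : ℝ) (h : u ∈ Set.Ioo (0:ℝ) Real.pi) : 0 < Real.cos (u/2) :=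
  Real.cos_pos_of_mem_Ioo ⟨by linarith [h.1, Real.pi_pos], by linarith [h.2]⟩

theorem Q_half_aux (u v : ℝ) (hu : u ∈ Set.Ioo (0:ℝ) Real.pi) (hv : v ∈ Set.Ioo (0:ℝ) Real.pi) :
    Q (1/2) u v = (Real.cos (u/2))^2 / (Real.cos (v/2))^2 := by
  have cu := cos_half_pos_aux u hu
  have cv := cos_half_pos_aux v hv
  have su : 0 < Real.sin (u/2) :=
    Real.sin_pos_of_pos_of_lt_pi (by linarith [hu.1]) (by linarith [hu.2, hu.1])
  have sv : 0 < Real.sin (v/2) :=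
    Real.sin_pos_of_pos_of_lt_pi (by linarith [hv.1]) (by linarith [hv.2, hv.1])
  have e1 : Real.sin u = 2 * Real.sin (u/2) * Real.cos (u/2) := by
    rw [← Real.sin_two_mul]; congr 1; ring
  have e2 : Real.sin v = 2 * Real.sin (v/2) * Real.cos (v/2) := by
    rw [← Real.sin_two_mul]; congr 1; ring
  unfold Q
  rw [show (1/2:ℝ) / (1 - 1/2) = 1 by norm_num, show (1:ℝ) / (1 - 1/2) = (2:ℕ) by norm_num,
    Real.rpow_one, Real.rpow_natCast, show (1 - 1/2 : ℝ) = 1/2 by norm_num,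
    show (1/2:ℝ) * u = u/2 by ring, show (1/2:ℝ) * v = v/2 by ring, e1, e2]
  field_simp

theorem inner_deriv_aux (t C k y : ℝ) (ht : 0 < t) (hC : 0 < C) (hk : 0 < k)
    (hkk : k^2 * (t + C^2) = C^2) :
    HasDerivAt (fun v : ℝ => v - k * (v - 2 * Real.arctan ((1-k) * (Real.sin (v/2) * Real.cos (v/2)) /
      ((Real.cos (v/2))^2 + k * (Real.sin (v/2))^2))))
      (t * (Real.cos (y/2))^2 / (t * (Real.cos (y/2))^2 + C^2)) y := by
  have hv : HasDerivAt (fun v : ℝ => v/2) (1/2) y := (hasDerivAt_id y).div_const 2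
  have hs := hv.sin
  have hc := hv.cos
  have h1 := Real.sin_sq_add_cos_sq (y/2)
  have hD : 0 < (Real.cos (y/2))^2 + k * (Real.sin (y/2))^2 := by
    rcases eq_or_ne (Real.cos (y/2)) 0 with h | h
    · rw [h] at h1 ⊢
      have : Real.sin (y/2)^2 = 1 := by linarith
      rw [this]; linarith
    · positivity
  have hN := (hs.mul hc).const_mul (1-k)
  have hDD := (hc.pow 2).add ((hs.pow 2).const_mul k)
  have hA := (hN.div hDD hD.ne').arctan
  have hfin := (hasDerivAt_id y).sub (((hasDerivAt_id y).sub (hA.const_mul 2)).const_mul k)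
  refine hfin.congr_deriv ?_
  simp only [Pi.mul_apply, Pi.add_apply, Pi.pow_apply, Pi.div_apply]
  generalize Real.sin (y/2) = s at *
  generalize Real.cos (y/2) = c at *
  have hP : 0 < c^2 + k^2 * s^2 := by
    rcases eq_or_ne c 0 with h | h
    · rw [h] at h1 ⊢
      have : s^2 = 1 := by linarith
      rw [this]; positivity
    · positivity
  have hX : ((1-k) * (s*c))^2 + (c^2 + k*s^2)^2 = c^2 + k^2*s^2 := by
    linear_combination (c^2 + k^2*s^2) * h1
  have hY : 1 + ((1-k) * (s*c) / (c^2 + k*s^2))^2 = (c^2 + k^2*s^2) / (c^2+k*s^2)^2 := by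
    rw [← hX]; field_simp; ring
  have hE : t * c^2 + C^2 = (t + C^2) * (c^2 + k^2 * s^2) := by
    linear_combination (-s^2) * hkk - C^2 * h1
  have hT : 0 < t + C^2 := by positivity
  have hZ : t * c^2 / (t * c^2 + C^2) = 1 - k^2 / (c^2 + k^2*s^2) := by
    rw [hE, div_eq_iff (by positivity)]
    field_simp
    linear_combination hE + hkk
  rw [hY, hZ]
  have hW : (1 - k) * (c * (1 / 2) * c + s * (-s * (1 / 2))) * (c^2 + k*s^2) -
      (1 - k) * (s * c) * (((2:ℕ):ℝ) * c ^ (2 - 1) * (-s * (1 / 2)) +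
        k * (((2:ℕ):ℝ) * s ^ (2 - 1) * (c * (1 / 2)))) = (1-k) * (c^2 - k*s^2) / 2 := by
    norm_num
    linear_combination ((1-k) * (c^2 - k*s^2) / 2) * h1
  rw [hW]
  have hV : 1 / ((c^2 + k^2*s^2) / (c^2+k*s^2)^2) * ((1-k) * (c^2 - k*s^2) / 2 / (c^2+k*s^2)^2)
      = (1-k) * (c^2 - k*s^2) / 2 / (c^2 + k^2*s^2) := by
    field_simp
  rw [hV]
  field_simp
  linear_combination (-k^2) * h1

theorem inner_aux (t C : ℝ) (ht : 0 < t) (hC : 0 < C) :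
    ∫ v in (0:ℝ)..Real.pi, t * (Real.cos (v/2))^2 / (t * (Real.cos (v/2))^2 + C^2)
      = Real.pi * (1 - C / Real.sqrt (t + C^2)) := by
  have hR : 0 < Real.sqrt (t + C^2) := Real.sqrt_pos.2 (by positivity)
  have hkk : (C / Real.sqrt (t + C^2))^2 * (t + C^2) = C^2 := by
    rw [div_pow, Real.sq_sqrt (by positivity)]
    field_simp
  rw [intervalIntegral.integral_eq_sub_of_hasDerivAt
    (fun y _ => inner_deriv_aux t C _ y ht hC (div_pos hC hR) hkk)]
  · simp; ring
  · apply Continuous.intervalIntegrable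
    apply Continuous.div (by fun_prop) (by fun_prop)
    intro x; positivity

theorem outer_aux (t : ℝ) (ht : 0 < t) :
    ∫ u in (0:ℝ)..Real.pi, Real.pi * (1 - Real.cos (u/2) / Real.sqrt (t + (Real.cos (u/2))^2))
      = 2 * Real.pi * Real.arctan (Real.sqrt t) := by
  have hd : ∀ y : ℝ, HasDerivAt (fun u : ℝ => Real.pi * (u - 2 * Real.arctan (Real.sin (u/2) /
      Real.sqrt (t + (Real.cos (u/2))^2))))
      (Real.pi * (1 - Real.cos (y/2) / Real.sqrt (t + (Real.cos (y/2))^2))) y := by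
    intro y
    have hv : HasDerivAt (fun v : ℝ => v/2) (1/2) y := (hasDerivAt_id y).div_const 2
    have hs := hv.sin
    have hc := hv.cos
    have h1 := Real.sin_sq_add_cos_sq (y/2)
    have hpos : 0 < t + (Real.cos (y/2))^2 := by positivity
    have hR := ((hc.pow 2).const_add t).sqrt hpos.ne'
    have hRp := Real.sqrt_pos.2 hpos
    have hA := (hs.div hR hRp.ne').arctan
    have hfin := (((hasDerivAt_id y).sub (hA.const_mul 2))).const_mul Real.pi
    refine hfin.congr_deriv ?_
    simp only [Pi.mul_apply, Pi.add_apply, Pi.pow_apply, Pi.div_apply]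
    have hsq := Real.sq_sqrt hpos.le
    generalize Real.sqrt (t + (Real.cos (y/2))^2) = R at *
    generalize Real.sin (y/2) = s at *
    generalize Real.cos (y/2) = c at *
    congr 1
    have hX : 1 + (s / R)^2 = (t+1) / R^2 := by
      field_simp; linarith
    rw [hX]
    norm_num
    field_simp
    linear_combination c * (hsq + h1)
  rw [intervalIntegral.integral_eq_sub_of_hasDerivAt (fun y _ => hd y)]
  · simp [Real.arctan_inv_of_pos (Real.sqrt_pos.2 ht)]
    ring
  · apply Continuous.intervalIntegrable
    apply Continuous.mul (by fun_prop)
    apply Continuous.sub (by fun_prop)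
    apply Continuous.div (by fun_prop) (by fun_prop)
    intro x
    exact (Real.sqrt_pos.2 (by positivity)).ne'

/-- For every `t > 0`, `F_{1/2}(t) = (2/π)·arctan(√t)`. -/
theorem stmt_2 (t : ℝ) (ht : 0 < t) :
    F (1/2) t = (2 / Real.pi) * Real.arctan (Real.sqrt t) := by
  unfold F
  rw [congr_Ioo_aux _ (fun u => Real.pi * (1 - Real.cos (u/2) /
    Real.sqrt (t + (Real.cos (u/2))^2))) ?_, outer_aux t ht]
  · have := Real.pi_pos
    field_simp
  · intro u hu
    have cu := cos_half_pos_aux u hu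
    rw [← inner_aux t _ ht cu]
    apply congr_Ioo_aux
    intro v hv
    have cv := cos_half_pos_aux v hv
    rw [Q_half_aux u v hu hv]
    field_simp
end

section
/- For every fixed t ∈ (0, 1], the map α ↦ F_α(t) is monotonically nondecreasing on (0, 1/2]: if 0 < α₁ ≤ α₂ ≤ 1/2 then F_{α₁}(t) ≤ F_{α₂}(t). -/
open Real

open MeasureTheory Filter Topology

noncomputable def hh (k : ℕ) (a : ℝ) : ℝ :=
  (1 - a ^ (2 * k + 3) - (1 - a) ^ (2 * k + 3)) / (1 - a)

lemma hh_eq (k : ℕ) (a : ℝ) (ha : a < 1) :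
    hh k a = (∑ j ∈ Finset.range (2 * k + 3), a ^ j) - (1 - a) ^ (2 * k + 2) := by
  have h : (1 - a) ≠ 0 := by linarith
  have := geom_sum_mul_neg a (2 * k + 3)
  unfold hh
  rw [div_eq_iff h, sub_mul, this]
  ring

lemma hh_mono (k : ℕ) {a b : ℝ} (ha : 0 ≤ a) (hab : a ≤ b) (hb : b < 1) : hh k a ≤ hh k b := by
  rw [hh_eq k a (by linarith), hh_eq k b hb]
  apply sub_le_sub
  · gcongr
  · have : 0 ≤ 1 - b := by linarith
    gcongr

lemma hh_nonneg (k : ℕ) {a : ℝ} (ha : 0 ≤ a) (hb : a < 1) : 0 ≤ hh k a := by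
  have := hh_mono k le_rfl ha hb
  simpa [hh] using this

noncomputable def KK (a y : ℝ) : ℝ :=
  log (1 - (1 - a) ^ 2 * y) + a / (1 - a) * log (1 - a ^ 2 * y) - 1 / (1 - a) * log (1 - y)

lemma KK_hasSum {a y : ℝ} (ha : 0 < a) (hb : a < 1) (hy : 0 ≤ y) (hy1 : y < 1) :
    HasSum (fun k : ℕ => y ^ (k + 1) / (k + 1) * hh k a) (KK a y) := by
  have key : ∀ c : ℝ, 0 ≤ c → c ≤ 1 → |c ^ 2 * y| < 1 := by
    intro c h0 h1
    rw [abs_of_nonneg (by positivity)]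
    have : c ^ 2 ≤ 1 := pow_le_one₀ h0 h1
    nlinarith
  have e1 := hasSum_pow_div_log_of_abs_lt_one (key (1 - a) (by linarith) (by linarith))
  have e2 := hasSum_pow_div_log_of_abs_lt_one (key a (by linarith) (by linarith))
  have e3 := hasSum_pow_div_log_of_abs_lt_one (x := y) (by rwa [abs_of_nonneg hy])
  have h : (1 - a) ≠ 0 := by linarith
  convert! ((e3.mul_left (1 / (1 - a))).sub (e1.add (e2.mul_left (a / (1 - a))))) using 1
  · funext k
    have : (k : ℝ) + 1 ≠ 0 := by positivity
    unfold hh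
    rw [mul_pow, mul_pow, ← pow_mul, ← pow_mul]
    field_simp
    ring
  · unfold KK
    ring

lemma KK_mono {a b y z : ℝ} (ha : 0 < a) (hab : a ≤ b) (hb : b < 1) (hy : 0 ≤ y) (hyz : y ≤ z)
    (hz : z < 1) : 0 ≤ KK a z - KK a y ∧ KK a z - KK a y ≤ KK b z - KK b y := by
  have ha1 : a < 1 := by linarith
  have hb0 : 0 < b := by linarith
  have A := (KK_hasSum ha ha1 (hy.trans hyz) hz).sub (KK_hasSum ha ha1 hy (by linarith))
  have B := (KK_hasSum hb0 hb (hy.trans hyz) hz).sub (KK_hasSum hb0 hb hy (by linarith))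
  have hp : ∀ k : ℕ, 0 ≤ z ^ (k + 1) / ((k : ℝ) + 1) - y ^ (k + 1) / (k + 1) := by
    intro k
    rw [sub_nonneg]
    gcongr
  constructor
  · refine A.nonneg fun k => ?_
    rw [← sub_mul]
    exact mul_nonneg (hp k) (hh_nonneg k ha.le ha1)
  · refine hasSum_le (fun k => ?_) A B
    rw [← sub_mul, ← sub_mul]
    exact mul_le_mul_of_nonneg_left (hh_mono k ha.le hab hb) (hp k)

lemma log_sin_tendsto {x : ℝ} (h0 : 0 < x) (h1 : x < 1) :
    Tendsto (fun n : ℕ => ∑ j ∈ Finset.range n, log (1 - x ^ 2 / ((j : ℝ) + 1) ^ 2)) atTop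
      (𝓝 (log (sin (π * x)) - log π - log x)) := by
  have hs : 0 < sin (π * x) := sin_pos_of_pos_of_lt_pi (by positivity) (by nlinarith [pi_pos])
  have h := (Real.tendsto_euler_sin_prod x).log hs.ne'
  have hpos : ∀ j : ℕ, 0 < 1 - x ^ 2 / ((j : ℝ) + 1) ^ 2 := by
    intro j
    rw [sub_pos, div_lt_one (by positivity)]
    have : (0:ℝ) ≤ j := by positivity
    nlinarith
  have := (h.sub_const (log π)).sub_const (log x)
  refine this.congr fun n => ?_
  rw [log_mul (by positivity) (Finset.prod_pos fun j _ => hpos j).ne',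
    log_mul pi_pos.ne' h0.ne', log_prod (fun j _ => (hpos j).ne')]
  ring

noncomputable def LA (a u : ℝ) : ℝ :=
  log (sin ((1 - a) * u)) + a / (1 - a) * log (sin (a * u)) - 1 / (1 - a) * log (sin u)

lemma LA_tendsto {a x y : ℝ} (ha : 0 < a) (hb : a < 1) (hx : 0 < x) (hx1 : x < 1)
    (hy : 0 < y) (hy1 : y < 1) :
    Tendsto (fun n : ℕ => ∑ j ∈ Finset.range n,
      (KK a (y ^ 2 / ((j : ℝ) + 1) ^ 2) - KK a (x ^ 2 / ((j : ℝ) + 1) ^ 2))) atTop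
      (𝓝 (LA a (π * y) - LA a (π * x))) := by
  have h : (1 - a) ≠ 0 := by linarith
  have main : ∀ x : ℝ, 0 < x → x < 1 → Tendsto (fun n : ℕ => ∑ j ∈ Finset.range n,
      KK a (x ^ 2 / ((j : ℝ) + 1) ^ 2)) atTop (𝓝 (LA a (π * x) - (log (1 - a)
        + a / (1 - a) * log a))) := by
    intro x hx hx1
    have h1 : 0 < 1 - a := by linarith
    have e1 := log_sin_tendsto (x := (1 - a) * x) (by positivity) (by nlinarith)
    have e2 := log_sin_tendsto (x := a * x) (by positivity) (by nlinarith)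
    have e3 := log_sin_tendsto hx hx1
    convert (e1.add (e2.const_mul (a / (1 - a)))).sub (e3.const_mul (1 / (1 - a))) using 1
    · funext n
      rw [Finset.mul_sum, Finset.mul_sum, ← Finset.sum_add_distrib, ← Finset.sum_sub_distrib]
      refine Finset.sum_congr rfl fun j _ => ?_
      unfold KK
      simp only [mul_pow, mul_div_assoc]
    · congr 1
      unfold LA
      rw [log_mul h hx.ne', log_mul ha.ne' hx.ne', mul_left_comm π, mul_left_comm π]
      field_simp
      ring
  convert (main y hy hy1).sub (main x hx hx1) using 1
  · funext n
    rw [Finset.sum_sub_distrib]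
  · congr 1
    ring

lemma LA_mono {a b u v : ℝ} (ha : 0 < a) (hab : a ≤ b) (hb : b < 1) (hu : 0 < u) (huv : u ≤ v)
    (hv : v < π) : 0 ≤ LA a v - LA a u ∧ LA a v - LA a u ≤ LA b v - LA b u := by
  have hpi := pi_pos
  obtain ⟨x, rfl⟩ : ∃ x, u = π * x := ⟨u / π, by field_simp⟩
  obtain ⟨y, rfl⟩ : ∃ y, v = π * y := ⟨v / π, by field_simp⟩
  have hx : 0 < x := by
    by_contra hc
    nlinarith
  have hxy : x ≤ y := le_of_mul_le_mul_left huv hpi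
  have hy1 : y < 1 := by
    by_contra hc
    nlinarith
  have A := LA_tendsto ha (by linarith) hx (by linarith) (by linarith) hy1
  have B := LA_tendsto (a := b) (by linarith) hb hx (by linarith) (by linarith) hy1
  have key : ∀ j : ℕ, _ := fun j => KK_mono (a := a) (b := b) (y := x ^ 2 / ((j : ℝ) + 1) ^ 2)
    (z := y ^ 2 / ((j : ℝ) + 1) ^ 2) ha hab hb (by positivity) (by gcongr) (by
      rw [div_lt_one (by positivity)]
      have : (0:ℝ) ≤ j := by positivity
      nlinarith)
  constructor
  · exact ge_of_tendsto' A fun n => Finset.sum_nonneg fun j _ => (key j).1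
  · exact le_of_tendsto_of_tendsto' A B fun n => Finset.sum_le_sum fun j _ => (key j).2

lemma Q_eq_s4 {a u v : ℝ} (ha : 0 < a) (hb : a < 1) (hu : u ∈ Set.Ioo 0 π) (hv : v ∈ Set.Ioo 0 π) :
    Q a u v = exp (LA a v - LA a u) := by
  have hs : ∀ c : ℝ, 0 < c → c ≤ 1 → ∀ w ∈ Set.Ioo 0 π, 0 < sin (c * w) := by
    intro c h0 h1 w hw
    exact sin_pos_of_pos_of_lt_pi (mul_pos h0 hw.1) (by nlinarith [hw.1, hw.2])
  have a1 := hs a ha hb.le u hu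
  have a2 := hs a ha hb.le v hv
  have b1 := hs (1 - a) (by linarith) (by linarith) u hu
  have b2 := hs (1 - a) (by linarith) (by linarith) v hv
  have c1 := sin_pos_of_pos_of_lt_pi hu.1 hu.2
  have c2 := sin_pos_of_pos_of_lt_pi hv.1 hv.2
  unfold Q
  rw [rpow_def_of_pos (by positivity), rpow_def_of_pos (by positivity),
    ← exp_log (div_pos b2 b1), ← exp_add, ← exp_add, log_div a2.ne' a1.ne', log_div c1.ne' c2.ne',
    log_div b2.ne' b1.ne']
  congr 1
  unfold LA
  ring

lemma G_mono {t p q : ℝ} (ht : 0 < t) (ht1 : t ≤ 1) (hp : 1 ≤ p) (hpq : p ≤ q) :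
    1 / (1 + p / t) + 1 / (1 + p⁻¹ / t) ≤ 1 / (1 + q / t) + 1 / (1 + q⁻¹ / t) := by
  have hq : 0 < q := by linarith
  have hp0 : 0 < p := by linarith
  have e : ∀ r : ℝ, 0 < r → 1 / (1 + r / t) + 1 / (1 + r⁻¹ / t)
      = 1 - (1 - t ^ 2) * (r / ((t + r) * (r * t + 1))) := by
    intro r hr
    have : t + r ≠ 0 := by positivity
    have : r * t + 1 ≠ 0 := by positivity
    have e1 : 1 / (1 + r / t) = t / (t + r) := by field_simp
    have e2 : 1 / (1 + r⁻¹ / t) = r * t / (r * t + 1) := by field_simp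
    rw [e1, e2]
    field_simp
    ring
  rw [e p hp0, e q hq]
  have : 0 ≤ 1 - t ^ 2 := by nlinarith
  have : q / ((t + q) * (q * t + 1)) ≤ p / ((t + p) * (p * t + 1)) := by
    rw [div_le_div_iff₀ (by positivity) (by positivity)]
    have : 0 ≤ t * ((q - p) * (p * q - 1)) :=
      mul_nonneg ht.le (mul_nonneg (by linarith) (by nlinarith))
    nlinarith
  nlinarith

lemma sym_le {t a b u v : ℝ} (ht : 0 < t) (ht1 : t ≤ 1) (ha : 0 < a) (hab : a ≤ b) (hb : b < 1)
    (hu : u ∈ Set.Ioo 0 π) (hv : v ∈ Set.Ioo 0 π) :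
    1 / (1 + Q a u v / t) + 1 / (1 + Q a v u / t)
      ≤ 1 / (1 + Q b u v / t) + 1 / (1 + Q b v u / t) := by
  wlog huv : u ≤ v generalizing u v
  · have := this hv hu (le_of_not_ge huv)
    linarith
  have hm := LA_mono ha hab hb hu.1 huv hv.2
  have inv : ∀ c, 0 < c → c < 1 → Q c v u = (Q c u v)⁻¹ := by
    intro c h0 h1
    rw [Q_eq_s4 h0 h1 hu hv, Q_eq_s4 h0 h1 hv hu, ← exp_neg]
    congr 1
    ring
  rw [inv a ha (by linarith), inv b (by linarith) hb]
  apply G_mono ht ht1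
  · rw [Q_eq_s4 ha (by linarith) hu hv]
    exact one_le_exp hm.1
  · rw [Q_eq_s4 ha (by linarith) hu hv, Q_eq_s4 (by linarith) hb hu hv]
    exact exp_le_exp.2 hm.2

lemma f_int {t a : ℝ} (ht : 0 < t) (ha : 0 < a) (hb : a < 1) :
    Integrable (Function.uncurry fun u v : ℝ => 1 / (1 + Q a u v / t))
      ((volume.restrict (Set.Ioo 0 π)).prod (volume.restrict (Set.Ioo 0 π))) := by
  have hm : Measurable (Function.uncurry fun u v : ℝ => 1 / (1 + Q a u v / t)) := by
    unfold Q Function.uncurry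
    fun_prop
  refine Integrable.of_bound hm.aestronglyMeasurable 1 ?_
  rw [Measure.prod_restrict]
  filter_upwards [ae_restrict_mem (measurableSet_Ioo.prod measurableSet_Ioo)] with p hp
  have : 0 ≤ Q a p.1 p.2 := by
    rw [Q_eq_s4 ha hb hp.1 hp.2]
    positivity
  simp only [Function.uncurry]
  rw [Real.norm_of_nonneg (by positivity), div_le_one (by positivity)]
  have : 0 ≤ Q a p.1 p.2 / t := by positivity
  linarith

lemma F_eq (a t : ℝ) : F a t = (1 / π ^ 2) * ∫ u in Set.Ioo 0 π, ∫ v in Set.Ioo 0 π,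
    1 / (1 + Q a u v / t) := by
  unfold F
  simp only [intervalIntegral.integral_of_le pi_pos.le, integral_Ioc_eq_integral_Ioo]

theorem stmt_4 (t : ℝ) (ht : t ∈ Set.Ioc (0:ℝ) 1) (α₁ α₂ : ℝ)
    (h1 : 0 < α₁) (h12 : α₁ ≤ α₂) (h2 : α₂ ≤ 1/2) :
    F α₁ t ≤ F α₂ t := by
  rw [F_eq, F_eq]
  apply mul_le_mul_of_nonneg_left _ (by positivity)
  have A := f_int ht.1 h1 (by linarith : α₁ < 1)
  have B := f_int ht.1 (by linarith : 0 < α₂) (by linarith)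
  rw [integral_integral A, integral_integral B]
  have hA := integral_prod_swap (μ := volume.restrict (Set.Ioo 0 π))
    (ν := volume.restrict (Set.Ioo 0 π)) (Function.uncurry fun u v : ℝ => 1 / (1 + Q α₁ u v / t))
  have hB := integral_prod_swap (μ := volume.restrict (Set.Ioo 0 π))
    (ν := volume.restrict (Set.Ioo 0 π)) (Function.uncurry fun u v : ℝ => 1 / (1 + Q α₂ u v / t))
  have C : ∫ p, (Function.uncurry (fun u v : ℝ => 1 / (1 + Q α₁ u v / t)) p
        + Function.uncurry (fun u v : ℝ => 1 / (1 + Q α₁ u v / t)) p.swap)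
        ∂((volume.restrict (Set.Ioo 0 π)).prod (volume.restrict (Set.Ioo 0 π)))
      ≤ ∫ p, (Function.uncurry (fun u v : ℝ => 1 / (1 + Q α₂ u v / t)) p
        + Function.uncurry (fun u v : ℝ => 1 / (1 + Q α₂ u v / t)) p.swap)
        ∂((volume.restrict (Set.Ioo 0 π)).prod (volume.restrict (Set.Ioo 0 π))) := by
    refine integral_mono_ae (A.add A.swap) (B.add B.swap) ?_
    rw [Measure.prod_restrict]
    filter_upwards [ae_restrict_mem (measurableSet_Ioo.prod measurableSet_Ioo)] with p hp
    exact sym_le ht.1 ht.2 h1 h12 (by linarith) hp.1 hp.2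
  have iA := integral_add A A.swap
  have iB := integral_add B B.swap
  simp only [Function.comp_def] at iA iB
  rw [iA, iB] at C
  rw [hA, hB] at C
  simp only [Function.uncurry] at C
  linarith
end

section
/- For every α ∈ (0, 1/2] and every t ∈ (0, 1], one has the two-sided bound 1/(1 + 1/t) ≤ F_α(t) ≤ (2/π)·arctan(√t). -/
open Real

lemma quad_aux (δ r m : ℝ) (h0 : 0 ≤ δ) (h1 : δ ≤ 1) (hm : 1 ≤ m) (hr : m ≤ r) :
    0 ≤ (r^2-1)*(r^2-m^2*δ^2)+δ*(2*m*r^3 - m^2*r^2 - r^2 - m^2*δ^2*(r^2-1)) := by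
  have hr1 : 1 ≤ r := hm.trans hr
  have e1 : 0 ≤ (r^2-1)*(r^2-1^2*δ^2)+δ*(2*1*r^3 - 1^2*r^2 - r^2 - 1^2*δ^2*(r^2-1)) := by
    have : (r^2-1)*(r^2-1^2*δ^2)+δ*(2*1*r^3 - 1^2*r^2 - r^2 - 1^2*δ^2*(r^2-1))
      = (r-1)*((r+1)*(r^2-δ^2-δ^3)+2*δ*r^2) := by ring
    rw [this]
    apply mul_nonneg (by linarith)
    obtain ⟨s, rfl⟩ : ∃ s, r = 1 + s := ⟨r-1, by ring⟩
    have hs : 0 ≤ s := by linarith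
    have d2 : δ^2 ≤ 1 := by nlinarith
    have d3 : δ^3 ≤ δ := by nlinarith
    have : (1+s+1)*((1+s)^2-δ^2-δ^3) ≥ (1+s+1)*((1+s)^2-1-δ) := by
      apply mul_le_mul_of_nonneg_left <;> linarith
    have h2 : (1+s+1)*((1+s)^2-1-δ)+2*δ*(1+s)^2 = 4*s+4*s^2+s^3 +δ*(3*s) + 2*δ*s^2 := by ring
    have h3 : 0 ≤ 4*s+4*s^2+s^3 +δ*(3*s) + 2*δ*s^2 := by positivity
    linarith
  have e2 : 0 ≤ (r^2-1)*(r^2-r^2*δ^2)+δ*(2*r*r^3 - r^2*r^2 - r^2 - r^2*δ^2*(r^2-1)) := by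
    have : (r^2-1)*(r^2-r^2*δ^2)+δ*(2*r*r^3 - r^2*r^2 - r^2 - r^2*δ^2*(r^2-1))
      = (r^2-1)*r^2*((1-δ^2)*(1+δ)) := by ring
    rw [this]
    have : 0 ≤ r^2-1 := by nlinarith
    have : 0 ≤ 1-δ^2 := by nlinarith
    positivity
  rcases eq_or_lt_of_le hr1 with h | h
  · have : m = 1 := by linarith
    subst this; simpa using e1
  have key : (r-1)*((r^2-1)*(r^2-m^2*δ^2)+δ*(2*m*r^3 - m^2*r^2 - r^2 - m^2*δ^2*(r^2-1)))
    = (r-m)*((r^2-1)*(r^2-1^2*δ^2)+δ*(2*1*r^3 - 1^2*r^2 - r^2 - 1^2*δ^2*(r^2-1)))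
    + (m-1)*((r^2-1)*(r^2-r^2*δ^2)+δ*(2*r*r^3 - r^2*r^2 - r^2 - r^2*δ^2*(r^2-1)))
    + (r-m)*(m-1)*(r-1)*((r^2-1)*δ^2+δ*(r^2+δ^2*(r^2-1))) := by ring
  have : 0 ≤ r^2-1 := by nlinarith
  have a1 : 0 ≤ r - m := by linarith
  have a2 : 0 ≤ m-1 := by linarith
  have a3 : 0 < r-1 := by linarith
  refine nonneg_of_mul_nonneg_right (a := r-1) ?_ a3
  rw [key]
  have := mul_nonneg a1 e1
  have := mul_nonneg a2 e2
  have : 0 ≤ (r-m)*(m-1)*(r-1)*((r^2-1)*δ^2+δ*(r^2+δ^2*(r^2-1))) := by positivity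
  linarith

lemma N_aux (δ sv cv sd cd : ℝ) (h0 : 0 ≤ δ) (h1 : δ ≤ 1) (hsv : 0 < sv) (hcv : 0 < cv)
    (hcd : 0 < cd) (pv : sv^2+cv^2=1) (pd : sd^2+cd^2=1)
    (l1 : δ * sv ≤ sd) (l2 : sd * cv ≤ δ * sv * cd) :
    0 ≤ δ*sv^2*(sv^2*cd^2-sd^2*cv^2)+2*δ*sv*cv*sd*cd - δ^2*sv^2*cv^2 - sd^2*cv^2 := by
  rcases eq_or_lt_of_le h0 with h | h
  · subst h
    have : sd = 0 := by nlinarith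
    subst this; simp
  have hy : 0 < δ * sv * cd := by positivity
  have cd1 : cd ≤ 1 := by nlinarith
  have := quad_aux δ (1/cv) (sd/(δ*sv*cd)) h0 h1 (by
    rw [le_div_iff₀ hy]
    have : δ*sv*cd ≤ δ*sv*1 := by gcongr
    linarith) (by
    rw [div_le_div_iff₀ hy hcv]; linarith)
  have h2 := mul_nonneg this (show 0 ≤ δ*sv^2*cd^2*cv^6/sv^0 by positivity)
  have e : ((1/cv)^2-1) = sv^2/cv^2 := by field_simp; linarith
  rw [e] at h2
  have : (sv ^ 2 / cv ^ 2 * ((1 / cv) ^ 2 - (sd / (δ * sv * cd)) ^ 2 * δ ^ 2) +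
          δ * (2 * (sd / (δ * sv * cd)) * (1 / cv) ^ 3 - (sd / (δ * sv * cd)) ^ 2 * (1 / cv) ^ 2 - (1 / cv) ^ 2 -
              (sd / (δ * sv * cd)) ^ 2 * δ ^ 2 * (sv ^ 2 / cv ^ 2))) *
      (δ * sv ^ 2 * cd ^ 2 * cv ^ 6 / sv ^ 0) = cv^2*(δ*sv^2*(sv^2*cd^2-sd^2*cv^2)+2*δ*sv*cv*sd*cd - δ^2*sv^2*cv^2*(cd^2+sd^2*sv^2/sv^2) - sd^2*cv^2) := by
    field_simp
    ring
  rw [this] at h2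
  have := nonneg_of_mul_nonneg_right h2 (by positivity : 0 < cv^2)
  have e3 : cd^2+sd^2*sv^2/sv^2 = 1 := by field_simp; linarith
  rw [e3] at this; linarith

lemma sin_scale (x l : ℝ) (hx : x ∈ Set.Icc 0 π) (h0 : 0 ≤ l) (h1 : l ≤ 1) :
    l * sin x ≤ sin (l * x) := by
  have h := strictConcaveOn_sin_Icc.concaveOn
  have h2 := h.2 (show (0:ℝ) ∈ Set.Icc 0 π from ⟨le_rfl, pi_pos.le⟩) hx
      (show 0 ≤ 1-l by linarith) h0 (by ring)
  simpa using h2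

lemma main_trig (α u : ℝ) (h0 : 0 < α) (h1 : α ≤ 1/2) (hu : 0 < u) (hu' : u < π) :
    (α*cos (α*u) * sin ((1-α)*u) - (1-α)*cos ((1-α)*u)*sin (α*u))^2 + sin (α*u)^2*sin ((1-α)*u)^2
     ≤ (1-α)*(1-cos u)*(sin (α*u) * sin ((1-α)*u)) := by
  have ea : α*u = u/2 - (1-2*α)*(u/2) := by ring
  have eb : (1-α)*u = u/2 + (1-2*α)*(u/2) := by ring
  have eu : cos u = 2*cos (u/2)^2 - 1 := by rw [← cos_two_mul]; ring_nf
  rw [ea, eb, eu, cos_sub, sin_sub, cos_add, sin_add]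
  obtain ⟨δ, hδ⟩ : ∃ δ, δ = 1 - 2*α := ⟨_, rfl⟩
  have hδ0 : 0 ≤ δ := by linarith
  have hδ1 : δ < 1 := by linarith
  have hα : α = (1-δ)/2 := by linarith
  rw [← hδ]
  obtain ⟨v, hv⟩ : ∃ v, v = u/2 := ⟨_, rfl⟩
  rw [← hv]
  have v0 : 0 < v := by linarith
  have v1 : v < π/2 := by linarith
  have d0 : 0 ≤ δ*v := by positivity
  have d1 : δ*v ≤ v := by nlinarith
  have hsv : 0 < sin v := sin_pos_of_pos_of_lt_pi v0 (by linarith)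
  have hcv : 0 < cos v := cos_pos_of_mem_Ioo ⟨by linarith, v1⟩
  have hcd : 0 < cos (δ*v) := cos_pos_of_mem_Ioo ⟨by linarith, by linarith⟩
  have l1 : δ * sin v ≤ sin (δ*v) := by
    exact sin_scale v δ ⟨v0.le, by linarith⟩ hδ0 hδ1.le
  have l2 : sin (δ*v) * cos v ≤ δ * sin v * cos (δ*v) := by
    have := sin_scale (v+δ*v) ((1-δ)/(1+δ)) ⟨by linarith, by linarith⟩
      (div_nonneg (by linarith) (by linarith)) (by rw [div_le_one (by linarith)]; linarith)
    have e : (1-δ)/(1+δ)*(v+δ*v) = v - δ*v := by field_simp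
    rw [e, div_mul_eq_mul_div, div_le_iff₀ (by linarith), sin_add, sin_sub] at this
    linarith
  have N := N_aux δ _ _ _ _ hδ0 hδ1.le hsv hcv hcd (sin_sq_add_cos_sq v) (sin_sq_add_cos_sq (δ*v)) l1 l2
  have p1 := sin_sq_add_cos_sq v
  have p2 := sin_sq_add_cos_sq (δ*v)
  subst hα
  generalize sin v = sv at *
  generalize cos v = cv at *
  generalize sin (δ*v) = sd at *
  generalize cos (δ*v) = cd at *
  rw [← sub_nonneg]
  convert N using 1
  clear N l1 l2 eu ea eb
  grind

noncomputable def Lf (α u : ℝ) : ℝ :=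
  α/(1-α) * log (sin (α*u)) + log (sin ((1-α)*u)) - 1/(1-α) * log (sin u)

noncomputable def Hf (u : ℝ) : ℝ := -2 * log (cos (u/2))

lemma sin_facts (α u : ℝ) (h0 : 0 < α) (h1 : α ≤ 1/2) (hu : u ∈ Set.Ioo 0 π) :
    0 < sin (α*u) ∧ 0 < sin ((1-α)*u) ∧ 0 < sin u ∧ 0 < cos (u/2) := by
  obtain ⟨a, b⟩ := hu
  refine ⟨sin_pos_of_pos_of_lt_pi (by positivity) (by nlinarith),
    sin_pos_of_pos_of_lt_pi (by nlinarith) (by nlinarith), sin_pos_of_pos_of_lt_pi a b,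
    cos_pos_of_mem_Ioo ⟨by linarith, by linarith⟩⟩

lemma Q_eq_s5 (α u₁ u₂ : ℝ) (h0 : 0 < α) (h1 : α ≤ 1/2) (hu : u₁ ∈ Set.Ioo 0 π)
    (hu' : u₂ ∈ Set.Ioo 0 π) : Q α u₁ u₂ = exp (Lf α u₂ - Lf α u₁) := by
  obtain ⟨a1, a2, a3, -⟩ := sin_facts α u₁ h0 h1 hu
  obtain ⟨b1, b2, b3, -⟩ := sin_facts α u₂ h0 h1 hu'
  unfold Q Lf
  rw [rpow_def_of_pos (by positivity), rpow_def_of_pos (by positivity),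
    ← exp_log (show 0 < sin ((1 - α) * u₂) / sin ((1 - α) * u₁) by positivity), ← exp_add, ← exp_add]
  rw [log_div b1.ne' a1.ne', log_div b2.ne' a2.ne', log_div a3.ne' b3.ne']
  ring_nf

lemma Lf_deriv (α u : ℝ) (h0 : 0 < α) (h1 : α ≤ 1/2) (hu : u ∈ Set.Ioo 0 π) :
    HasDerivAt (Lf α) (α/(1-α) * (α*cos (α*u)/sin (α*u)) + (1-α)*cos ((1-α)*u)/sin ((1-α)*u)
      - 1/(1-α)*(cos u/sin u)) u := by
  obtain ⟨a1, a2, a3, -⟩ := sin_facts α u h0 h1 hu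
  have e (c : ℝ) (hc : sin (c*u) ≠ 0) : HasDerivAt (fun u => log (sin (c*u))) (c*cos (c*u)/sin (c*u)) u := by
    have := (((hasDerivAt_id' u).const_mul c).sin).log hc
    exact this.congr_deriv (by ring)
  exact (((e α a1.ne').const_mul _).add (e (1-α) a2.ne')).sub
    (((hasDerivAt_sin u).log a3.ne').const_mul _)

lemma Hf_deriv (u : ℝ) (hu : 0 < cos (u/2)) :
    HasDerivAt Hf (sin (u/2)/cos (u/2)) u := by
  have := ((((hasDerivAt_id' u).div_const 2).cos).log hu.ne').const_mul (-2)
  exact this.congr_deriv (by ring)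

lemma Lf_deriv_eq (α u : ℝ) (h0 : 0 < α) (h1 : α ≤ 1/2) (hu : u ∈ Set.Ioo 0 π) :
    α/(1-α) * (α*cos (α*u)/sin (α*u)) + (1-α)*cos ((1-α)*u)/sin ((1-α)*u) - 1/(1-α)*(cos u/sin u)
    = ((α*cos (α*u) * sin ((1-α)*u) - (1-α)*cos ((1-α)*u)*sin (α*u))^2
      + sin (α*u)^2*sin ((1-α)*u)^2) / ((1-α)*(sin (α*u)*sin ((1-α)*u)*sin u)) := by
  obtain ⟨a1, a2, a3, -⟩ := sin_facts α u h0 h1 hu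
  have hb : 0 < 1 - α := by linarith
  have es : sin u = sin (α*u) * cos ((1-α)*u) + cos (α*u) * sin ((1-α)*u) := by
    rw [← sin_add]; ring_nf
  have ec : cos u = cos (α*u) * cos ((1-α)*u) - sin (α*u) * sin ((1-α)*u) := by
    rw [← cos_add]; ring_nf
  rw [eq_div_iff (by positivity)]
  have : (α/(1-α) * (α*cos (α*u)/sin (α*u)) + (1-α)*cos ((1-α)*u)/sin ((1-α)*u) - 1/(1-α)*(cos u/sin u)) * ((1-α)*(sin (α*u)*sin ((1-α)*u)*sin u))
    = α^2*cos (α*u)*sin ((1-α)*u)*sin u + (1-α)^2*cos ((1-α)*u)*sin (α*u)*sin u - cos u * sin (α*u)*sin ((1-α)*u) := by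
    field_simp
  rw [this, es, ec]
  ring

lemma Lf_mono (α : ℝ) (h0 : 0 < α) (h1 : α ≤ 1/2) : MonotoneOn (Lf α) (Set.Ioo 0 π) := by
  apply monotoneOn_of_deriv_nonneg (convex_Ioo _ _)
  · exact fun u hu => (Lf_deriv α u h0 h1 hu).continuousAt.continuousWithinAt
  · rw [interior_Ioo]
    exact fun u hu => (Lf_deriv α u h0 h1 hu).differentiableAt.differentiableWithinAt
  · rw [interior_Ioo]
    intro u hu
    rw [(Lf_deriv α u h0 h1 hu).deriv, Lf_deriv_eq α u h0 h1 hu]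
    obtain ⟨a1, a2, a3, -⟩ := sin_facts α u h0 h1 hu
    have hb : 0 < 1 - α := by linarith
    positivity

lemma HL_mono (α : ℝ) (h0 : 0 < α) (h1 : α ≤ 1/2) :
    MonotoneOn (fun u => Hf u - Lf α u) (Set.Ioo 0 π) := by
  have hd : ∀ u ∈ Set.Ioo 0 π, HasDerivAt (fun u => Hf u - Lf α u) _ u := fun u hu =>
    (Hf_deriv u (sin_facts α u h0 h1 hu).2.2.2).sub (Lf_deriv α u h0 h1 hu)
  apply monotoneOn_of_deriv_nonneg (convex_Ioo _ _)
  · exact fun u hu => (hd u hu).continuousAt.continuousWithinAt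
  · rw [interior_Ioo]
    exact fun u hu => (hd u hu).differentiableAt.differentiableWithinAt
  · rw [interior_Ioo]
    intro u hu
    rw [(hd u hu).deriv, Lf_deriv_eq α u h0 h1 hu]
    obtain ⟨a1, a2, a3, a4⟩ := sin_facts α u h0 h1 hu
    have hb : 0 < 1 - α := by linarith
    have M := main_trig α u h0 h1 hu.1 hu.2
    rw [sub_nonneg, div_le_iff₀ (by positivity)]
    refine M.trans (le_of_eq ?_)
    have e1 : sin u = 2 * sin (u/2) * cos (u/2) := by rw [← sin_two_mul]; ring_nf
    have e2 : 1 - cos u = 2*sin (u/2)^2 := by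
      have : cos u = 2*cos (u/2)^2 - 1 := by rw [← cos_two_mul]; ring_nf
      rw [this]; linarith [sin_sq_add_cos_sq (u/2)]
    rw [e1, e2]
    field_simp

lemma psi_mono (t x y : ℝ) (ht : 0 < t) (ht1 : t ≤ 1) (hx : 0 ≤ x) (hxy : x ≤ y) :
    1/(1+exp x/t) + 1/(1+exp (-x)/t) ≤ 1/(1+exp y/t) + 1/(1+exp (-y)/t) := by
  have e (z : ℝ) : 1/(1+exp z/t) + 1/(1+exp (-z)/t)
      = t*(2*cosh z+2*t)/(1+t^2+t*(2*cosh z)) := by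
    have hz := exp_pos z
    have hc := cosh_pos z
    have h2 : 2*cosh z = exp z + (exp z)⁻¹ := by rw [cosh_eq, exp_neg]; ring
    rw [h2, exp_neg]
    field_simp
    ring
  have hc : cosh x ≤ cosh y := by
    rw [cosh_le_cosh, abs_of_nonneg hx, abs_of_nonneg (hx.trans hxy)]; exact hxy
  have := cosh_pos x
  have := cosh_pos y
  rw [e, e, div_le_div_iff₀ (by positivity) (by positivity)]
  have : 0 ≤ 2*t*(1-t^2)*(cosh y - cosh x) := by
    have : 0 ≤ 1 - t^2 := by nlinarith
    have : 0 ≤ cosh y - cosh x := by linarith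
    positivity
  nlinarith

open MeasureTheory

noncomputable def μ0 : Measure ℝ := volume.restrict (Set.Ioo 0 π)

noncomputable def G (t : ℝ) (L : ℝ → ℝ) (p : ℝ × ℝ) : ℝ := 1/(1+exp (L p.2 - L p.1)/t)

instance : IsFiniteMeasure μ0 := by unfold μ0; infer_instance

lemma G_int (t : ℝ) (ht : 0 < t) (L : ℝ → ℝ) (hL : Measurable L) :
    Integrable (G t L) (μ0.prod μ0) := by
  apply Integrable.of_bound (C := 1)
  · apply Measurable.aestronglyMeasurable
    unfold G
    fun_prop
  · refine Filter.Eventually.of_forall fun p => ?_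
    unfold G
    have : 0 < exp (L p.2 - L p.1)/t := by positivity
    rw [norm_of_nonneg (by positivity), div_le_one (by positivity)]
    linarith

lemma G_comp (t : ℝ) (ht : 0 < t) (ht1 : t ≤ 1) (L K : ℝ → ℝ) (hL : Measurable L) (hK : Measurable K)
    (mL : MonotoneOn L (Set.Ioo 0 π)) (mK : MonotoneOn (fun u => K u - L u) (Set.Ioo 0 π)) :
    ∫ p, G t L p ∂(μ0.prod μ0) ≤ ∫ p, G t K p ∂(μ0.prod μ0) := by
  have key (L : ℝ → ℝ) (hL : Measurable L) :
      2 * ∫ p, G t L p ∂(μ0.prod μ0) = ∫ p, (G t L p + G t L p.swap) ∂(μ0.prod μ0) := by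
    have h1 := integral_add (G_int t ht L hL) (G_int t ht L hL).swap
    have h2 := integral_prod_swap (μ := μ0) (ν := μ0) (G t L)
    simp only [Function.comp_apply] at h1
    rw [h1, h2]
    ring
  have : 2 * ∫ p, G t L p ∂(μ0.prod μ0) ≤ 2 * ∫ p, G t K p ∂(μ0.prod μ0) := by
    rw [key L hL, key K hK]
    apply integral_mono_ae ((G_int t ht L hL).add (G_int t ht L hL).swap)
      ((G_int t ht K hK).add (G_int t ht K hK).swap)
    have : μ0.prod μ0 = (volume.prod volume).restrict (Set.Ioo 0 π ×ˢ Set.Ioo 0 π) := by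
      unfold μ0; rw [Measure.prod_restrict]
    rw [this]
    refine (ae_restrict_iff' (measurableSet_Ioo.prod measurableSet_Ioo)).2
      (Filter.Eventually.of_forall ?_)
    rintro ⟨a, b⟩ ⟨ha, hb⟩
    show G t L (a, b) + G t L (b, a) ≤ G t K (a, b) + G t K (b, a)
    clear key
    simp only [G]
    rcases le_total a b with h | h
    · have h1 := mL ha hb h
      have h2 := mK ha hb h
      have := psi_mono t (L b - L a) (K b - K a) ht ht1 (by linarith) (by simp only at h2; linarith)
      simpa only [neg_sub] using this
    · have h1 := mL hb ha h
      have h2 := mK hb ha h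
      have := psi_mono t (L a - L b) (K a - K b) ht ht1 (by linarith) (by simp only at h2; linarith)
      simp only [neg_sub] at this
      linarith
  linarith

lemma Lf_meas (α : ℝ) : Measurable (Lf α) := by unfold Lf; fun_prop
lemma Hf_meas : Measurable Hf := by unfold Hf; fun_prop

lemma F_eq_s5 (α t : ℝ) (h0 : 0 < α) (h1 : α ≤ 1/2) (ht : 0 < t) :
    F α t = 1/π^2 * ∫ p, G t (Lf α) p ∂(μ0.prod μ0) := by
  unfold F
  rw [integral_prod _ (G_int t ht _ (Lf_meas α))]
  congr 1
  rw [intervalIntegral.integral_of_le pi_pos.le, integral_Ioc_eq_integral_Ioo]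
  refine setIntegral_congr_fun measurableSet_Ioo fun u hu => ?_
  rw [intervalIntegral.integral_of_le pi_pos.le, integral_Ioc_eq_integral_Ioo]
  refine setIntegral_congr_fun measurableSet_Ioo fun w hw => ?_
  simp only [G]
  rw [Q_eq_s5 α u w h0 h1 hu hw]

lemma inner_int (l : ℝ) (hl : 0 < l) :
    ∫ u in (0:ℝ)..π, l/(cos (u/2)^2 + l^2*sin (u/2)^2) = π := by
  have pos (u : ℝ) (m : ℝ) (hm : 0 < m) : 0 < cos (u/2)^2 + m*sin (u/2)^2 := by
    rcases eq_or_ne (cos (u/2)) 0 with h | h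
    · have := sin_sq_add_cos_sq (u/2)
      rw [h] at this ⊢
      have : sin (u/2)^2 = 1 := by linarith
      rw [this]; linarith
    · positivity
  have hd (u : ℝ) : HasDerivAt (fun u => u - 2*arctan ((1-l)*(sin (u/2)*cos (u/2))/(cos (u/2)^2 + l*sin (u/2)^2)))
      (l/(cos (u/2)^2 + l^2*sin (u/2)^2)) u := by
    have hv := (hasDerivAt_id' u).div_const 2
    have hs := hv.sin
    have hc := hv.cos
    have p1 := pos u l hl
    have p2 := pos u (l^2) (by positivity)
    have := (hasDerivAt_id' u).sub (((((hs.mul hc).const_mul (1-l)).div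
      ((hc.pow 2).add ((hs.pow 2).const_mul l)) p1.ne').arctan).const_mul 2)
    refine this.congr_deriv ?_
    have pp := sin_sq_add_cos_sq (u/2)
    simp only [Pi.mul_apply, Pi.add_apply, Pi.pow_apply, Pi.div_apply]
    have p3 : (cos (u/2)^2 + l*sin (u/2)^2)^2 + ((1-l)*(sin (u/2)*cos (u/2)))^2 = cos (u/2)^2 + l^2*sin (u/2)^2 := by
      linear_combination (cos (u/2)^2 + l^2*sin (u/2)^2)*pp
    have p4 : 1 + ((1-l)*(sin (u/2)*cos (u/2))/(cos (u/2)^2 + l*sin (u/2)^2))^2 = (cos (u/2)^2 + l^2*sin (u/2)^2)/(cos (u/2)^2 + l*sin (u/2)^2)^2 := by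
      rw [← p3]; field_simp
    rw [p4]
    field_simp
    generalize sin (u/2) = s at *
    generalize cos (u/2) = c at *
    clear p1 p2 p4 hs hc hv this
    grind
  rw [intervalIntegral.integral_eq_sub_of_hasDerivAt (fun u _ => hd u)]
  · simp
  · apply Continuous.intervalIntegrable
    exact Continuous.div (by fun_prop) (by fun_prop) (fun u => (pos u (l^2) (by positivity)).ne')

lemma outer_int (t : ℝ) (ht : 0 < t) :
    ∫ u in (0:ℝ)..π, cos (u/2)/√(t + cos (u/2)^2) = π - 2*arctan (√t) := by
  have hd (u : ℝ) : HasDerivAt (fun u => 2*arcsin (sin (u/2)/√(1+t))) (cos (u/2)/√(t + cos (u/2)^2)) u := by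
    have hv := (hasDerivAt_id' u).div_const 2
    have hs := (hv.sin).div_const (√(1+t))
    have hr : 0 < √(1+t) := by positivity
    have hr2 : √(1+t)^2 = 1+t := sq_sqrt (by positivity)
    have pp := sin_sq_add_cos_sq (u/2)
    have hlt : (sin (u/2)/√(1+t))^2 < 1 := by
      rw [div_pow, hr2, div_lt_one (by positivity)]
      nlinarith [sq_nonneg (cos (u/2))]
    have hlt' := abs_lt.1 ((sq_lt_one_iff_abs_lt_one _).1 hlt)
    have := ((hasDerivAt_arcsin hlt'.1.ne' hlt'.2.ne).comp u hs).const_mul 2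
    refine this.congr_deriv ?_
    have : √(1 - (sin (u/2)/√(1+t))^2) = √(t + cos (u/2)^2)/√(1+t) := by
      rw [← sqrt_div (by positivity), div_pow, hr2]
      congr 1
      field_simp
      linarith
    rw [this]
    have : 0 < √(t + cos (u/2)^2) := by positivity
    field_simp
  rw [intervalIntegral.integral_eq_sub_of_hasDerivAt (fun u _ => hd u)]
  · rw [arctan_eq_arccos (sqrt_nonneg t), sq_sqrt ht.le, arccos]
    simp
    ring
  · apply Continuous.intervalIntegrable
    exact Continuous.div (by fun_prop) (by fun_prop) (fun u => by positivity)

lemma H_int (t : ℝ) (ht : 0 < t) :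
    ∫ p, G t Hf p ∂(μ0.prod μ0) = 2 * π * arctan (√t) := by
  rw [integral_prod _ (G_int t ht _ Hf_meas)]
  have : ∀ u ∈ Set.Ioo 0 π, ∫ w, G t Hf (u, w) ∂μ0 = π - π*(cos (u/2)/√(t + cos (u/2)^2)) := by
    intro u hu
    have hcu := (sin_facts (1/2) u (by norm_num) le_rfl hu).2.2.2
    obtain ⟨l, hl⟩ : ∃ l, l = cos (u/2)/√(t + cos (u/2)^2) := ⟨_, rfl⟩
    have hl0 : 0 < l := by rw [hl]; positivity
    have hl2 : l^2 = cos (u/2)^2/(t + cos (u/2)^2) := by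
      rw [hl, div_pow, sq_sqrt (by positivity)]
    have hc : Continuous fun w => l/(cos (w/2)^2 + l^2*sin (w/2)^2) := by
      refine Continuous.div (by fun_prop) (by fun_prop) (fun w => ?_)
      have := sin_sq_add_cos_sq (w/2)
      rcases eq_or_ne (cos (w/2)) 0 with h | h
      · have : sin (w/2) ≠ 0 := by intro h'; simp [h, h'] at this
        positivity
      · positivity
    have : ∫ w, G t Hf (u, w) ∂μ0 = ∫ w in (0:ℝ)..π, (1 - l*(l/(cos (w/2)^2 + l^2*sin (w/2)^2))) := by
      rw [intervalIntegral.integral_of_le pi_pos.le, integral_Ioc_eq_integral_Ioo]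
      refine setIntegral_congr_fun measurableSet_Ioo fun w hw => ?_
      have hcw := (sin_facts (1/2) w (by norm_num) le_rfl hw).2.2.2
      have he : exp (Hf w - Hf u) = cos (u/2)^2/cos (w/2)^2 := by
        unfold Hf
        rw [show -2 * log (cos (w/2)) - -2 * log (cos (u/2)) = log (cos (u/2)^2/cos (w/2)^2) by
          rw [log_div (by positivity) (by positivity), log_pow, log_pow]; push_cast; ring]
        rw [exp_log (by positivity)]
      simp only [G]
      rw [he, ← mul_div_assoc, ← pow_two, hl2]
      have : sin (w/2)^2 = 1 - cos (w/2)^2 := by linarith [sin_sq_add_cos_sq (w/2)]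
      rw [this]
      have e : cos (w / 2) ^ 2 + cos (u / 2) ^ 2 / (t + cos (u / 2) ^ 2) * (1 - cos (w / 2) ^ 2)
        = (t * cos (w/2)^2 + cos (u/2)^2)/(t + cos (u / 2) ^ 2) := by field_simp; ring
      rw [e]
      field_simp
      ring
    rw [this, intervalIntegral.integral_sub (by simp) ((hc.const_mul l).intervalIntegrable _ _),
      intervalIntegral.integral_const_mul, inner_int l hl0, ← hl]
    simp
    ring
  have h2 : ∫ u, ∫ w, G t Hf (u, w) ∂μ0 ∂μ0 = ∫ u in (0:ℝ)..π, (π - π*(cos (u/2)/√(t + cos (u/2)^2))) := by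
    rw [intervalIntegral.integral_of_le pi_pos.le, integral_Ioc_eq_integral_Ioo]
    exact setIntegral_congr_fun measurableSet_Ioo this
  have hc : Continuous fun u => cos (u/2)/√(t + cos (u/2)^2) :=
    Continuous.div (by fun_prop) (by fun_prop) (fun u => by positivity)
  rw [h2, intervalIntegral.integral_sub (by simp) ((hc.const_mul π).intervalIntegrable _ _),
      intervalIntegral.integral_const_mul, outer_int t ht]
  simp
  ring

/-- For every `α ∈ (0, 1/2]` and every `t ∈ (0, 1]`,
`1/(1 + 1/t) ≤ F_α(t) ≤ (2/π)·arctan(√t)`. -/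
theorem stmt_5 (α t : ℝ) (hα : α ∈ Set.Ioc (0:ℝ) (1/2)) (ht : t ∈ Set.Ioc (0:ℝ) 1) :
    1 / (1 + 1 / t) ≤ F α t ∧ F α t ≤ (2 / Real.pi) * Real.arctan (Real.sqrt t) := by
  obtain ⟨h0, h1⟩ := hα
  obtain ⟨t0, t1⟩ := ht
  rw [F_eq_s5 α t h0 h1 t0]
  have hp := pi_pos
  constructor
  · have := G_comp t t0 t1 (fun _ => 0) (Lf α) measurable_const (Lf_meas α) monotoneOn_const
      (by simpa using Lf_mono α h0 h1)
    have e : ∫ p, G t (fun _ => 0) p ∂(μ0.prod μ0) = π^2 * (1/(1+1/t)) := by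
      simp only [G, sub_zero, exp_zero]
      rw [MeasureTheory.integral_const, MeasureTheory.measureReal_def, ← Set.univ_prod_univ,
        MeasureTheory.Measure.prod_prod]
      simp only [μ0, MeasureTheory.Measure.restrict_apply_univ, Real.volume_Ioo, sub_zero,
        ENNReal.toReal_mul, ENNReal.toReal_ofReal hp.le, smul_eq_mul]
      ring
    rw [e] at this
    calc 1/(1+1/t) = 1/π^2 * (π^2 * (1/(1+1/t))) := by field_simp
      _ ≤ _ := by gcongr
  · have := G_comp t t0 t1 (Lf α) Hf (Lf_meas α) Hf_meas (Lf_mono α h0 h1) (HL_mono α h0 h1)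
    rw [H_int t t0] at this
    calc _ ≤ 1/π^2 * (2 * π * arctan (√t)) := by gcongr
      _ = _ := by field_simp
end

section
/- For every α ∈ (0, 1/2], the function q_α(u) = (sin(α u))^{α/(1−α)} · (sin u)^{−1/(1−α)} · sin((1−α)u) is monotonically nondecreasing in u on the interval (0, π); equivalently, for 0 < u ≤ v < π one has q_α(u) ≤ q_α(v). -/
open Real

lemma aux_h (c : ℝ) (h0 : 0 < c) (h1 : c < 1) (u : ℝ) (hu : 0 < u) (hv : u < Real.pi) :
    0 ≤ c * Real.cos (c * u) * Real.sin u - Real.sin (c * u) * Real.cos u := by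
  have hd : ∀ x : ℝ, HasDerivAt
      (fun x => c * Real.cos (c * x) * Real.sin x - Real.sin (c * x) * Real.cos x)
      ((1 - c ^ 2) * Real.sin (c * x) * Real.sin x) x := by
    intro x
    have hc : HasDerivAt (fun x : ℝ => c * x) c x := by
      simpa using (hasDerivAt_id x).const_mul c
    have := ((hc.cos.const_mul c).mul (Real.hasDerivAt_sin x)).sub
      (hc.sin.mul (Real.hasDerivAt_cos x))
    refine this.congr_deriv ?_
    ring
  have hm : MonotoneOn
      (fun x => c * Real.cos (c * x) * Real.sin x - Real.sin (c * x) * Real.cos x)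
      (Set.Icc 0 Real.pi) := by
    apply monotoneOn_of_deriv_nonneg (convex_Icc _ _)
    · exact fun x _ => (hd x).continuousAt.continuousWithinAt
    · exact fun x _ => (hd x).differentiableAt.differentiableWithinAt
    · intro x hx
      rw [interior_Icc] at hx
      rw [(hd x).deriv]
      have a1 : 0 ≤ Real.sin x := Real.sin_nonneg_of_nonneg_of_le_pi hx.1.le hx.2.le
      have a2 : 0 ≤ Real.sin (c * x) := by
        apply Real.sin_nonneg_of_nonneg_of_le_pi
        · exact mul_nonneg h0.le hx.1.le
        · nlinarith [hx.1, hx.2]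
      have a3 : 0 ≤ 1 - c ^ 2 := by nlinarith
      positivity
  have := hm (Set.left_mem_Icc.2 Real.pi_pos.le) ⟨hu.le, hv.le⟩ hu.le
  simpa using this

lemma aux_ratio (c : ℝ) (h0 : 0 < c) (h1 : c < 1) :
    MonotoneOn (fun u => Real.sin (c * u) / Real.sin u) (Set.Ioo 0 Real.pi) := by
  have hd : ∀ x ∈ Set.Ioo 0 Real.pi, HasDerivAt (fun u => Real.sin (c * u) / Real.sin u)
      ((c * Real.cos (c * x) * Real.sin x - Real.sin (c * x) * Real.cos x) / Real.sin x ^ 2) x := by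
    intro x hx
    have hc : HasDerivAt (fun x : ℝ => c * x) c x := by
      simpa using (hasDerivAt_id x).const_mul c
    have := hc.sin.div (Real.hasDerivAt_sin x) (Real.sin_pos_of_pos_of_lt_pi hx.1 hx.2).ne'
    refine this.congr_deriv ?_
    ring
  apply monotoneOn_of_deriv_nonneg (convex_Ioo _ _)
  · exact fun x hx => (hd x hx).continuousAt.continuousWithinAt
  · rw [interior_Ioo]
    exact fun x hx => (hd x hx).differentiableAt.differentiableWithinAt
  · intro x hx
    rw [interior_Ioo] at hx
    rw [(hd x hx).deriv]
    exact div_nonneg (aux_h c h0 h1 x hx.1 hx.2) (sq_nonneg _)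

lemma aux_pos (c : ℝ) (h0 : 0 < c) (h1 : c < 1) (u : ℝ) (hu : 0 < u) (hv : u < Real.pi) :
    0 < Real.sin (c * u) := by
  apply Real.sin_pos_of_pos_of_lt_pi (mul_pos h0 hu)
  nlinarith

lemma aux_q (α : ℝ) (h0 : 0 < α) (h1 : α < 1) (u : ℝ) (hu : 0 < u) (hv : u < Real.pi) :
    q α u = (Real.sin (α * u) / Real.sin u) ^ (α / (1 - α)) *
      (Real.sin ((1 - α) * u) / Real.sin u) := by
  have hs := Real.sin_pos_of_pos_of_lt_pi hu hv
  have ha := aux_pos α h0 h1 u hu hv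
  have hne : (1 - α) ≠ 0 := by linarith
  have e : -(1 / (1 - α)) = -(α / (1 - α)) + -1 := by
    field_simp
    ring
  unfold q
  rw [e, Real.rpow_add hs, Real.rpow_neg_one, Real.rpow_neg hs.le, Real.div_rpow ha.le hs.le]
  ring

theorem stmt_8 (α : ℝ) (hα : α ∈ Set.Ioc (0:ℝ) (1/2)) (u v : ℝ)
    (hu : 0 < u) (huv : u ≤ v) (hv : v < Real.pi) :
    q α u ≤ q α v := by
  obtain ⟨h0, h2⟩ := hα
  have h1 : α < 1 := by linarith
  have hu' : u < Real.pi := by linarith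
  have hv' : 0 < v := by linarith
  rw [aux_q α h0 h1 u hu hu', aux_q α h0 h1 v hv' hv]
  have su := Real.sin_pos_of_pos_of_lt_pi hu hu'
  have sv := Real.sin_pos_of_pos_of_lt_pi hv' hv
  have r1 := aux_ratio α h0 h1 ⟨hu, hu'⟩ ⟨hv', hv⟩ huv
  have r2 := aux_ratio (1 - α) (by linarith) (by linarith) ⟨hu, hu'⟩ ⟨hv', hv⟩ huv
  have p1 := aux_pos α h0 h1 u hu hu'
  have p2 := aux_pos (1 - α) (by linarith) (by linarith) u hu hu'
  have p3 := aux_pos α h0 h1 v hv' hv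
  apply mul_le_mul _ r2 (by positivity) (by positivity)
  exact Real.rpow_le_rpow (by positivity) r1 (div_nonneg h0.le (by linarith))
end

section
/- For every α ∈ (0, 1/2], the function g_α(u) = (α u/(1−α))·(cos(α u)/sin(α u)) + (1/(1−α)²)·log(sin(α u)) − (1/(1−α)²)·log(sin u) − u·cos((1−α)u)/sin((1−α)u) is monotonically nondecreasing in u on the interval (0, π). -/
open Real

/-- `g_α(u) = (α u/(1−α))·(cos(α u)/sin(α u)) + (1/(1−α)²)·log(sin(α u))
− (1/(1−α)²)·log(sin u) − u·cos((1−α)u)/sin((1−α)u)`. -/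
noncomputable def g (α u : ℝ) : ℝ :=
  (α * u / (1 - α)) * (Real.cos (α * u) / Real.sin (α * u))
    + (1 / (1 - α) ^ 2) * Real.log (Real.sin (α * u))
    - (1 / (1 - α) ^ 2) * Real.log (Real.sin u)
    - u * Real.cos ((1 - α) * u) / Real.sin ((1 - α) * u)

lemma aux_mono (f f' : ℝ → ℝ) (hf : ∀ x, 0 < x → x < π → HasDerivAt f (f' x) x)
    (hn : ∀ x, 0 < x → x < π → 0 ≤ f' x) {x y : ℝ} (hx : 0 < x) (hxy : x ≤ y) (hy : y < π) :
    f x ≤ f y := by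
  have h : MonotoneOn f (Set.Ioo 0 π) := by
    apply monotoneOn_of_deriv_nonneg (convex_Ioo 0 π)
    · intro z hz
      exact (hf z hz.1 hz.2).continuousAt.continuousWithinAt
    · intro z hz
      rw [interior_Ioo] at hz
      exact (hf z hz.1 hz.2).differentiableAt.differentiableWithinAt
    · intro z hz
      rw [interior_Ioo] at hz
      rw [(hf z hz.1 hz.2).deriv]
      exact hn z hz.1 hz.2
  exact h ⟨hx, lt_of_le_of_lt hxy hy⟩ ⟨lt_of_lt_of_le hx hxy, hy⟩ hxy

lemma aux_sin {x : ℝ} (hx : 0 < x) (hy : x < π) : x * cos x ≤ sin x := by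
  have h : MonotoneOn (fun x => sin x - x * cos x) (Set.Icc 0 π) := by
    apply monotoneOn_of_deriv_nonneg (convex_Icc 0 π)
    · fun_prop
    · fun_prop
    · intro z hz
      rw [interior_Icc] at hz
      have hd : HasDerivAt (fun x => sin x - x * cos x) (z * sin z) z := by
        refine ((hasDerivAt_sin z).sub ((hasDerivAt_id z).mul (hasDerivAt_cos z))).congr_deriv ?_
        simp
      rw [hd.deriv]
      exact mul_nonneg hz.1.le (sin_pos_of_pos_of_lt_pi hz.1 hz.2).le
  have := h ⟨le_refl 0, pi_pos.le⟩ ⟨hx.le, hy.le⟩ hx.le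
  simp at this
  linarith

noncomputable def auxG (x : ℝ) : ℝ := (x - sin x * cos x) / sin x ^ 2

lemma auxG_nonneg {x : ℝ} (hx : 0 < x) : 0 ≤ auxG x := by
  unfold auxG
  apply div_nonneg _ (sq_nonneg _)
  have := sin_lt (by linarith : 0 < 2 * x)
  rw [sin_two_mul] at this
  linarith

lemma auxF_deriv {x : ℝ} (hx : 0 < x) (hy : x < π) :
    HasDerivAt (fun x => x * (cos x / sin x)) (- auxG x) x := by
  have hs := (sin_pos_of_pos_of_lt_pi hx hy).ne'
  refine ((hasDerivAt_id x).mul ((hasDerivAt_cos x).div (hasDerivAt_sin x) hs)).congr_deriv ?_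
  have := sin_sq_add_cos_sq x
  simp only [id, auxG, Pi.div_apply]
  field_simp
  linear_combination (-x) * this

lemma auxG_mono {x y : ℝ} (hx : 0 < x) (hxy : x ≤ y) (hy : y < π) : auxG x ≤ auxG y := by
  apply aux_mono auxG (fun x => 2 * (sin x - x * cos x) / sin x ^ 3) _ _ hx hxy hy
  · intro z h0 h1
    have hs := (sin_pos_of_pos_of_lt_pi h0 h1).ne'
    unfold auxG
    refine (((hasDerivAt_id z).sub ((hasDerivAt_sin z).mul (hasDerivAt_cos z))).div
      ((hasDerivAt_sin z).pow 2) (pow_ne_zero 2 hs)).congr_deriv ?_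
    have := sin_sq_add_cos_sq z
    simp only [id, Pi.mul_apply, Pi.sub_apply, Pi.pow_apply]
    field_simp
    push_cast
    simp only [pow_one]
    linear_combination (sin z ^ 2) * this
  · intro z h0 h1
    have hs := (sin_pos_of_pos_of_lt_pi h0 h1)
    have := aux_sin h0 h1
    apply div_nonneg _ (by positivity)
    linarith

lemma auxF_anti {x y : ℝ} (hx : 0 < x) (hxy : x ≤ y) (hy : y < π) :
    y * (cos y / sin y) ≤ x * (cos x / sin x) := by
  have := aux_mono (fun x => - (x * (cos x / sin x))) auxG
    (fun z h0 h1 => (auxF_deriv h0 h1).neg.congr_deriv (neg_neg _))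
    (fun z h0 _ => auxG_nonneg h0) hx hxy hy
  simpa using this

/-- For every `α ∈ (0, 1/2]`, the function `g_α` is monotonically nondecreasing on `(0, π)`. -/
theorem stmt_9 (α : ℝ) (hα : α ∈ Set.Ioc (0:ℝ) (1/2)) (u v : ℝ)
    (hu : 0 < u) (huv : u ≤ v) (hv : v < Real.pi) :
    g α u ≤ g α v := by
  obtain ⟨ha, ha2⟩ := hα
  have hb : 0 < 1 - α := by linarith
  have hlt : ∀ c z : ℝ, c ≤ 1 → 0 < z → z < π → c * z < π := fun c z h h0 h1 => by nlinarith
  apply aux_mono (g α) (fun x => (1 / (1 - α)) * (-auxG (α * x) * α)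
    + (1 / (1 - α) ^ 2) * (cos (α * x) * α / sin (α * x)) - (1 / (1 - α) ^ 2) * (cos x / sin x)
    - (1 / (1 - α)) * (-auxG ((1 - α) * x) * (1 - α))) _ _ hu huv hv
  · intro z h0 h1
    have ha1 := hlt α z (by linarith) h0 h1
    have hb1 := hlt (1 - α) z (by linarith) h0 h1
    have hl : ∀ c : ℝ, HasDerivAt (fun x => c * x) c z := fun c => by
      simpa using (hasDerivAt_id z).const_mul c
    have e1 := ((auxF_deriv (mul_pos ha h0) ha1).comp z (hl α)).const_mul (1 / (1 - α))
    have e2 := ((auxF_deriv (mul_pos hb h0) hb1).comp z (hl (1 - α))).const_mul (1 / (1 - α))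
    have e3 := ((hl α).sin.log (sin_pos_of_pos_of_lt_pi (mul_pos ha h0) ha1).ne').const_mul
      (1 / (1 - α) ^ 2)
    have e4 := ((hasDerivAt_sin z).log (sin_pos_of_pos_of_lt_pi h0 h1).ne').const_mul
      (1 / (1 - α) ^ 2)
    refine (((e1.add e3).sub e4).sub e2).congr_of_eventuallyEq (Filter.Eventually.of_forall ?_)
    intro x
    simp only [g, Function.comp, Pi.add_apply, Pi.sub_apply]
    field_simp
  · intro z h0 h1
    have ha1 := hlt α z (by linarith) h0 h1
    have hb1 := hlt (1 - α) z (by linarith) h0 h1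
    have k1 := auxG_mono (mul_pos ha h0) (by nlinarith : α * z ≤ (1 - α) * z) hb1
    have k0 := auxG_nonneg (mul_pos ha h0)
    have k2 := auxF_anti (mul_pos ha h0) (by nlinarith : α * z ≤ z) h1
    have k3 : cos z / sin z ≤ cos (α * z) * α / sin (α * z) := by
      apply le_of_mul_le_mul_left _ h0
      calc _ ≤ _ := k2
        _ = _ := by ring
    have k4 := mul_le_mul_of_nonneg_left k3 (by positivity : 0 ≤ 1 / (1 - α) ^ 2)
    have k5 : (1 / (1 - α)) * (auxG (α * z) * α) ≤
        (1 / (1 - α)) * (auxG ((1 - α) * z) * (1 - α)) := by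
      apply mul_le_mul_of_nonneg_left _ (by positivity)
      apply mul_le_mul k1 (by linarith) ha.le (k0.trans k1)
    simp only [neg_mul, mul_neg]
    linarith
end

section
/- For every α ∈ [0, 1/2] and every u ∈ [0, π], one has (1−α)·sin(α u) ≥ α·sin((1−α)u). -/
/-- For every `α ∈ [0, 1/2]` and every `u ∈ [0, π]`, `(1−α)·sin(α u) ≥ α·sin((1−α)u)`. -/
theorem stmt_10 (α u : ℝ) (hα : α ∈ Set.Icc (0:ℝ) (1/2)) (hu : u ∈ Set.Icc (0:ℝ) Real.pi) :
    (1 - α) * Real.sin (α * u) ≥ α * Real.sin ((1 - α) * u) := by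
  obtain ⟨h0, h1⟩ := hα
  obtain ⟨u0, u1⟩ := hu
  have hp : 0 < 1 - α := by linarith
  have ht0 : 0 ≤ α / (1 - α) := by positivity
  have ht1 : 0 ≤ 1 - α / (1 - α) := by
    rw [sub_nonneg, div_le_one hp]; linarith
  have hx : (1 - α) * u ∈ Set.Icc (0:ℝ) Real.pi := ⟨by positivity, by nlinarith⟩
  have hz : (0:ℝ) ∈ Set.Icc (0:ℝ) Real.pi := ⟨le_refl _, Real.pi_pos.le⟩
  have h := strictConcaveOn_sin_Icc.concaveOn.2 hx hz ht0 ht1 (by ring)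
  simp only [smul_eq_mul, Real.sin_zero, mul_zero, add_zero] at h
  have e : α / (1 - α) * ((1 - α) * u) = α * u := by field_simp
  rw [e] at h
  have h2 := mul_le_mul_of_nonneg_left h hp.le
  have e2 : (1 - α) * (α / (1 - α) * Real.sin ((1 - α) * u)) = α * Real.sin ((1 - α) * u) := by
    field_simp
  linarith
end

section
/- For every α ∈ [0, 1/2] and every u ∈ [0, π], one has α·sin(u)·cos(α u) ≥ cos(u)·sin(α u); equivalently, α·sin(u − α u) + (1−α)·cos(u)·sin(α u) ≥ 0. -/
/-- For every `α ∈ [0, 1/2]` and every `u ∈ [0, π]`,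
`α·sin(u)·cos(α u) ≥ cos(u)·sin(α u)`. -/
theorem stmt_11 (α u : ℝ) (hα : α ∈ Set.Icc (0:ℝ) (1/2)) (hu : u ∈ Set.Icc (0:ℝ) Real.pi) :
    α * Real.sin u * Real.cos (α * u) ≥ Real.cos u * Real.sin (α * u) := by
  obtain ⟨h0, h1⟩ := hα
  have hd : ∀ x : ℝ, HasDerivAt
      (fun x : ℝ => α * Real.sin x * Real.cos (α * x) - Real.cos x * Real.sin (α * x))
      ((1 - α ^ 2) * (Real.sin x * Real.sin (α * x))) x := by
    intro x
    have hl : HasDerivAt (fun x : ℝ => α * x) α x := by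
      simpa using (hasDerivAt_id x).const_mul α
    have h := (((Real.hasDerivAt_sin x).const_mul α).mul hl.cos).sub
      ((Real.hasDerivAt_cos x).mul hl.sin)
    refine h.congr_deriv ?_
    ring
  have hm : MonotoneOn
      (fun x : ℝ => α * Real.sin x * Real.cos (α * x) - Real.cos x * Real.sin (α * x))
      (Set.Icc 0 Real.pi) := by
    apply monotoneOn_of_deriv_nonneg (convex_Icc _ _)
    · exact fun x _ => (hd x).continuousAt.continuousWithinAt
    · exact fun x _ => (hd x).differentiableAt.differentiableWithinAt
    · intro x hx
      rw [interior_Icc] at hx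
      obtain ⟨hx0, hx1⟩ := hx
      rw [(hd x).deriv]
      have a1 : 0 ≤ Real.sin x := Real.sin_nonneg_of_nonneg_of_le_pi hx0.le hx1.le
      have a2 : 0 ≤ Real.sin (α * x) :=
        Real.sin_nonneg_of_nonneg_of_le_pi (by positivity) (by nlinarith)
      have a3 : 0 ≤ 1 - α ^ 2 := by nlinarith
      positivity
  have := hm (Set.left_mem_Icc.2 Real.pi_pos.le) hu hu.1
  simp at this
  linarith
end

section
/- For every α ∈ (0, 1/2] and every u ∈ (0, π/2], the function q_α(u) = (sin(α u))^{α/(1−α)} · (sin u)^{−1/(1−α)} · sin((1−α)u) satisfies 1/4 ≤ α^{α/(1−α)}·(1−α) ≤ q_α(u) ≤ (sin(α π/2))^{α/(1−α)} · cos(α π/2) ≤ 1. -/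
open Real

lemma sin_conc (b u : ℝ) (hb : 0 ≤ b) (hb1 : b ≤ 1) (hu : 0 ≤ u) (hu1 : u ≤ π) :
    b * Real.sin u ≤ Real.sin (b * u) := by
  have h := strictConcaveOn_sin_Icc.concaveOn.2 (x := u) ⟨hu, hu1⟩ (y := 0)
    ⟨le_refl _, Real.pi_pos.le⟩ hb (sub_nonneg.2 hb1) (by ring)
  simpa using h

lemma ratio_mono (b u : ℝ) (hb : 0 < b) (hb1 : b < 1) (hu : 0 < u) (hu1 : u ≤ π / 2) :
    Real.sin (b * u) / Real.sin u ≤ Real.sin (b * (π / 2)) := by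
  have hp := Real.pi_pos
  have hs : ∀ x ∈ Set.Icc u (π / 2), 0 < Real.sin x := fun x hx =>
    Real.sin_pos_of_pos_of_lt_pi (by linarith [hx.1]) (by linarith [hx.2])
  have hd : ∀ x ∈ Set.Icc u (π / 2), HasDerivAt (fun x => Real.sin (b * x) / Real.sin x)
      ((Real.cos (b * x) * b * Real.sin x - Real.sin (b * x) * Real.cos x) / Real.sin x ^ 2) x := by
    intro x hx
    have h1 : HasDerivAt (fun x => Real.sin (b * x)) (Real.cos (b * x) * b) x := by
      have := ((hasDerivAt_id x).const_mul b).sin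
      simpa using this
    exact h1.div (Real.hasDerivAt_sin x) (hs x hx).ne'
  have hm : MonotoneOn (fun x => Real.sin (b * x) / Real.sin x) (Set.Icc u (π / 2)) := by
    apply monotoneOn_of_deriv_nonneg (convex_Icc _ _)
    · exact fun x hx => (hd x hx).continuousAt.continuousWithinAt
    · exact fun x hx => (hd x (interior_subset hx)).differentiableAt.differentiableWithinAt
    · intro x hx
      have hx := interior_subset hx
      rw [(hd x hx).deriv]
      apply div_nonneg _ (sq_nonneg _)
      have h1 := sin_conc (1 - b) x (by linarith) (by linarith) (by linarith [hx.1])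
        (by linarith [hx.2])
      have h2 : Real.sin ((1 - b) * x) = Real.sin x * Real.cos (b * x) -
          Real.cos x * Real.sin (b * x) := by
        rw [← Real.sin_sub]; ring_nf
      have h3 : (1 - b) * Real.sin x * Real.cos (b * x) ≤ (1 - b) * Real.sin x :=
        mul_le_of_le_one_right (mul_nonneg (by linarith) (hs x hx).le) (Real.cos_le_one _)
      linarith
  have := hm ⟨le_refl _, hu1⟩ ⟨hu1, le_refl _⟩ hu1
  simpa using this

/-- For every `α ∈ (0, 1/2]` and every `u ∈ (0, π/2]`,
`1/4 ≤ α^{α/(1−α)}·(1−α) ≤ q_α(u) ≤ (sin(α π/2))^{α/(1−α)} · cos(α π/2) ≤ 1`. -/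
theorem stmt_12 (α u : ℝ) (hα : α ∈ Set.Ioc (0:ℝ) (1/2)) (hu : u ∈ Set.Ioc (0:ℝ) (Real.pi / 2)) :
    1/4 ≤ α ^ (α / (1 - α)) * (1 - α) ∧
    α ^ (α / (1 - α)) * (1 - α) ≤ q α u ∧
    q α u ≤ Real.sin (α * Real.pi / 2) ^ (α / (1 - α)) * Real.cos (α * Real.pi / 2) ∧
    Real.sin (α * Real.pi / 2) ^ (α / (1 - α)) * Real.cos (α * Real.pi / 2) ≤ 1 := by
  obtain ⟨ha, ha2⟩ := hα
  obtain ⟨hu0, hu1⟩ := hu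
  have hp := Real.pi_pos
  have h1a : 0 < 1 - α := by linarith
  have he : 0 ≤ α / (1 - α) := by positivity
  have hsu : 0 < Real.sin u := Real.sin_pos_of_pos_of_lt_pi hu0 (by linarith)
  have hau : α * u ≤ π / 2 := by nlinarith
  have hsa : 0 < Real.sin (α * u) := Real.sin_pos_of_pos_of_lt_pi (by positivity) (by linarith)
  have hap : α * π / 2 ≤ π / 2 := by nlinarith
  have hsp : 0 < Real.sin (α * π / 2) :=
    Real.sin_pos_of_pos_of_lt_pi (by positivity) (by linarith)
  have hcp : 0 ≤ Real.cos (α * π / 2) :=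
    Real.cos_nonneg_of_neg_pi_div_two_le_of_le (by nlinarith) hap
  have hq : q α u = (Real.sin (α * u) / Real.sin u) ^ (α / (1 - α)) *
      (Real.sin ((1 - α) * u) / Real.sin u) := by
    have e : -(1 / (1 - α)) = -(α / (1 - α)) + (-1) := by field_simp; ring
    rw [q, e, Real.rpow_add hsu, Real.rpow_neg_one, Real.rpow_neg hsu.le,
      Real.div_rpow hsa.le hsu.le]
    ring
  have l1 : α ≤ Real.sin (α * u) / Real.sin u := by
    rw [le_div_iff₀ hsu]; exact sin_conc _ _ ha.le (by linarith) hu0.le (by linarith)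
  have l2 : 1 - α ≤ Real.sin ((1 - α) * u) / Real.sin u := by
    rw [le_div_iff₀ hsu]; exact sin_conc _ _ h1a.le (by linarith) hu0.le (by linarith)
  have r1 := ratio_mono α u ha (by linarith) hu0 hu1
  have r2 := ratio_mono (1 - α) u h1a (by linarith) hu0 hu1
  rw [show α * (π / 2) = α * π / 2 by ring] at r1
  rw [show (1 - α) * (π / 2) = π / 2 - α * π / 2 by ring, Real.sin_pi_div_two_sub] at r2
  refine ⟨?_, ?_, ?_, ?_⟩
  · have key : (1 / 2 : ℝ) ≤ α ^ (α / (1 - α)) := by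
      rw [Real.le_rpow_iff_log_le (by norm_num) ha, div_mul_eq_mul_div, le_div_iff₀ h1a]
      have h2 := Real.log_two_gt_d9
      have h3 := Real.one_sub_inv_le_log_of_pos (show 0 < 2 * α by positivity)
      rw [Real.log_mul (by norm_num) ha.ne'] at h3
      have h4 := mul_le_mul_of_nonneg_left h3 ha.le
      have h5 : α * (1 - (2 * α)⁻¹) = α - 1 / 2 := by field_simp
      rw [h5] at h4
      rw [one_div, Real.log_inv]
      nlinarith
    nlinarith
  · rw [hq]
    exact mul_le_mul (Real.rpow_le_rpow ha.le l1 he) l2 h1a.le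
      (Real.rpow_nonneg (ha.le.trans l1) _)
  · rw [hq]
    exact mul_le_mul (Real.rpow_le_rpow (ha.le.trans l1) r1 he) r2 (h1a.le.trans l2)
      (Real.rpow_nonneg hsp.le _)
  · exact mul_le_one₀ (Real.rpow_le_one hsp.le (Real.sin_le_one _) he) hcp (Real.cos_le_one _)
end

section
/- For every z ∈ [0, 1], one has −log(1 − (2/π)·arctan(z)) ≥ (2/π)·z. -/
/-- For every `z ∈ [0, 1]`, `−log(1 − (2/π)·arctan(z)) ≥ (2/π)·z`. -/
theorem stmt_13 (z : ℝ) (hz : z ∈ Set.Icc (0:ℝ) 1) :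
    -Real.log (1 - (2 / Real.pi) * Real.arctan z) ≥ (2 / Real.pi) * z := by
  have hpi := Real.pi_pos
  have hu : ∀ x : ℝ, 0 < 1 - (2 / Real.pi) * Real.arctan x := by
    intro x
    have h := Real.arctan_lt_pi_div_two x
    have : (2 / Real.pi) * Real.arctan x < (2 / Real.pi) * (Real.pi / 2) := by gcongr
    have h2 : (2 / Real.pi) * (Real.pi / 2) = 1 := by field_simp
    linarith
  have hd : ∀ x : ℝ, HasDerivAt
      (fun x => -Real.log (1 - (2 / Real.pi) * Real.arctan x) - (2 / Real.pi) * x)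
      (-((-((2 / Real.pi) * (1 / (1 + x ^ 2)))) / (1 - (2 / Real.pi) * Real.arctan x))
        - (2 / Real.pi) * 1) x := by
    intro x
    exact (((((Real.hasDerivAt_arctan x).const_mul (2 / Real.pi)).const_sub 1).log
      (hu x).ne').neg).sub ((hasDerivAt_id x).const_mul (2 / Real.pi))
  have hm : MonotoneOn
      (fun x => -Real.log (1 - (2 / Real.pi) * Real.arctan x) - (2 / Real.pi) * x)
      (Set.Icc 0 1) := by
    apply monotoneOn_of_deriv_nonneg (convex_Icc 0 1)
    · exact fun x _ => (hd x).continuousAt.continuousWithinAt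
    · exact fun x _ => (hd x).differentiableAt.differentiableWithinAt
    · intro x hx
      rw [interior_Icc] at hx
      rw [(hd x).deriv]
      have h0 : 0 ≤ Real.arctan x := by
        have := Real.arctan_strictMono.monotone hx.1.le
        simpa using this
      have h1 : Real.arctan x ≤ Real.pi / 4 := by
        have := Real.arctan_strictMono.monotone hx.2.le
        simpa using this
      have hc := Real.one_sub_mul_le_cos (x := 2 * Real.arctan x) (by linarith) (by linarith)
      rw [Real.cos_two_mul, Real.cos_sq_arctan] at hc
      have hux := hu x
      have hx2 : 0 < 1 + x ^ 2 := by positivity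
      have key : 1 - (2 / Real.pi) * Real.arctan x ≤ 1 / (1 + x ^ 2) := by linarith
      have : 1 ≤ (1 / (1 + x ^ 2)) / (1 - (2 / Real.pi) * Real.arctan x) := by
        rwa [le_div_iff₀ hux, one_mul]
      have h3 := mul_le_mul_of_nonneg_left this (by positivity : 0 ≤ 2 / Real.pi)
      rw [neg_div, neg_neg, mul_div_assoc]
      linarith
  have := hm (Set.left_mem_Icc.2 zero_le_one) hz hz.1
  simp at this
  linarith
end

section
/- Let θ > 0, let ε satisfy 0 < ε < θ, let N ≥ 1 be a real number and δ ∈ (0, 1). If M is a positive real number with M ≥ (π/2)·√(θ/ε)·log(N/δ), then N·(1 − (2/π)·arctan(√(ε/θ)))^M ≤ δ. -/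
lemma aux_arctan (t : ℝ) (ht : 0 ≤ t) : t - t ^ 2 / 4 ≤ Real.arctan t := by
  have hd : ∀ x : ℝ, HasDerivAt (fun x : ℝ => Real.arctan x - (x - x ^ 2 / 4))
      (1 / (1 + x ^ 2) - (1 - (2 * x) / 4)) x := by
    intro x
    have h2 : HasDerivAt (fun x : ℝ => x ^ 2 / 4) ((2 * x) / 4) x := by
      simpa using (hasDerivAt_pow 2 x).div_const 4
    exact (Real.hasDerivAt_arctan x).sub ((hasDerivAt_id x).sub h2)
  have hm : MonotoneOn (fun x : ℝ => Real.arctan x - (x - x ^ 2 / 4)) (Set.Ici 0) := by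
    apply monotoneOn_of_deriv_nonneg (convex_Ici 0)
    · exact fun x _ => (hd x).continuousAt.continuousWithinAt
    · exact fun x _ => (hd x).differentiableAt.differentiableWithinAt
    · intro x hx
      rw [interior_Ici] at hx
      have hx : 0 < x := hx
      rw [(hd x).deriv]
      have : 1 / (1 + x ^ 2) - (1 - (2 * x) / 4) = x * (1 - x) ^ 2 / (2 * (1 + x ^ 2)) := by
        field_simp
        ring
      rw [this]
      positivity
  have := hm (Set.mem_Ici.2 le_rfl) (Set.mem_Ici.2 ht) ht
  simp at this
  linarith

lemma aux_exp (x : ℝ) (h0 : 0 ≤ x) (h1 : x ≤ 1) :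
    1 - x + x ^ 2 / 2 - x ^ 3 / 6 ≤ Real.exp (-x) := by
  have h := Real.exp_bound (x := -x) (by rw [abs_neg, abs_of_nonneg h0]; exact h1)
    (n := 5) (by norm_num)
  rw [abs_neg, abs_of_nonneg h0] at h
  have h := (abs_le.1 h).1
  simp [Finset.sum_range_succ, Nat.factorial] at h
  have h5 : x ^ 5 ≤ x ^ 4 := pow_le_pow_of_le_one h0 h1 (by norm_num)
  have h4 : 0 ≤ x ^ 4 := by positivity
  nlinarith

lemma aux_main (t : ℝ) (h0 : 0 ≤ t) (h1 : t ≤ 1) :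
    1 - (2 / Real.pi) * Real.arctan t ≤ Real.exp (-(2 / Real.pi * t)) := by
  have hp := Real.pi_gt_three
  have hp2 : Real.pi < 3.15 := Real.pi_lt_d2
  have hc : 2 / Real.pi ≤ 1 := by rw [div_le_one (by linarith)]; linarith
  set c := 2 / Real.pi with hcdef
  have hc0 : 0 < c := by positivity
  have ha := mul_le_mul_of_nonneg_left (aux_arctan t h0) hc0.le
  have he := aux_exp (c * t) (by positivity) (by nlinarith)
  have hk : 1 / 4 ≤ c / 2 - c ^ 2 / 6 := by
    have : c / 2 - c ^ 2 / 6 - 1 / 4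
        = (Real.pi - 2 / 3 - Real.pi ^ 2 / 4) / Real.pi ^ 2 := by
      rw [hcdef]; field_simp; ring
    have h2 : 0 ≤ (Real.pi - 2 / 3 - Real.pi ^ 2 / 4) / Real.pi ^ 2 := by
      apply div_nonneg _ (by positivity)
      nlinarith
    linarith
  have hk2 : 0 ≤ c / 2 - c ^ 2 * t / 6 - 1 / 4 := by
    have : c ^ 2 * t ≤ c ^ 2 := mul_le_of_le_one_right (by positivity) h1
    linarith
  have hk3 : 0 ≤ c * t ^ 2 * (c / 2 - c ^ 2 * t / 6 - 1 / 4) := by positivity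
  nlinarith

/-- Let `θ > 0`, `0 < ε < θ`, `N ≥ 1` a real number and `δ ∈ (0, 1)`. If `M` is a positive real
number with `M ≥ (π/2)·√(θ/ε)·log(N/δ)`, then `N·(1 − (2/π)·arctan(√(ε/θ)))^M ≤ δ`. -/
theorem stmt_14 (θ ε N δ M : ℝ) (hθ : 0 < θ) (hε : 0 < ε) (hεθ : ε < θ)
    (hN : 1 ≤ N) (hδ : δ ∈ Set.Ioo (0:ℝ) 1) (hM0 : 0 < M)
    (hM : M ≥ (Real.pi / 2) * Real.sqrt (θ / ε) * Real.log (N / δ)) :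
    N * (1 - (2 / Real.pi) * Real.arctan (Real.sqrt (ε / θ))) ^ M ≤ δ := by
  obtain ⟨hd0, hd1⟩ := hδ
  have hp := Real.pi_pos
  have hN0 : 0 < N := by linarith
  have ht : 0 < Real.sqrt (ε / θ) := Real.sqrt_pos.2 (by positivity)
  have ht1 : Real.sqrt (ε / θ) ≤ 1 := by
    rw [Real.sqrt_le_iff, one_pow, div_le_one hθ]; exact ⟨zero_le_one, hεθ.le⟩
  have hinv : Real.sqrt (θ / ε) = (Real.sqrt (ε / θ))⁻¹ := by
    rw [← Real.sqrt_inv, inv_div]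
  rw [hinv] at hM
  set t := Real.sqrt (ε / θ)
  have hb : 0 ≤ 1 - (2 / Real.pi) * Real.arctan t := by
    have := Real.arctan_lt_pi_div_two t
    have h2 : (2 / Real.pi) * Real.arctan t ≤ (2 / Real.pi) * (Real.pi / 2) := by gcongr
    have h3 : (2 / Real.pi) * (Real.pi / 2) = 1 := by field_simp
    linarith
  have hL : Real.log (N / δ) ≤ 2 / Real.pi * t * M := by
    have := mul_le_mul_of_nonneg_left hM (show 0 ≤ 2 / Real.pi * t by positivity)
    have h3 : 2 / Real.pi * t * (Real.pi / 2 * t⁻¹ * Real.log (N / δ)) = Real.log (N / δ) := by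
      field_simp
    linarith
  calc N * (1 - (2 / Real.pi) * Real.arctan t) ^ M
      ≤ N * (Real.exp (-(2 / Real.pi * t))) ^ M := by
        gcongr
        exact aux_main t ht.le ht1
    _ = N * Real.exp (-(2 / Real.pi * t * M)) := by
        rw [← Real.exp_mul]; ring_nf
    _ ≤ N * Real.exp (-Real.log (N / δ)) := by gcongr
    _ = δ := by
        rw [Real.exp_neg, Real.exp_log (by positivity)]
        field_simp
end
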